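/- arXiv:2412.06563 — 2 statements merged into one kernel-verified Lean document; each statement's English description precedes it below -/
import Mathlib

section
/- For a nonempty open bounded convex set Ω ⊂ R^d, d≥2: |Ω|^{(d-1)/d} / P(Ω) ≤ (d^{(d-1)/d}/ω_d^{1/d}) · (2ρ(Ω)/diam(Ω))^{1/d}, where ρ is the inradius and ω_d = |B_1|. -/
open MeasureTheory Metric Set Bornology Pointwise

noncomputable def pCap (d : ℕ) (p : ℝ) (K : Set (EuclideanSpace ℝ (Fin d))) : ℝ :=
  sInf { c : ℝ | ∃ u : EuclideanSpace ℝ (Fin d) → ℝ,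
    Continuous u ∧ Differentiable ℝ u ∧
    (∀ x ∈ K, 1 ≤ u x) ∧
    (∀ ε > 0, volume {x | ε < u x} < ⊤) ∧
    c = ∫ x, ‖fderiv ℝ u x‖ ^ p }

noncomputable def torsion (d : ℕ) (q : ℝ) (Ω : Set (EuclideanSpace ℝ (Fin d))) : ℝ :=
  (sSup { c : ℝ | ∃ ψ : EuclideanSpace ℝ (Fin d) → ℝ,
    Continuous ψ ∧ Differentiable ℝ ψ ∧ tsupport ψ ⊆ Ω ∧ ψ ≠ 0 ∧
    c = (∫ x in Ω, |ψ x|) ^ q / ∫ x in Ω, ‖fderiv ℝ ψ x‖ ^ q }) ^ (1 / (q - 1))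

noncomputable def perim (d : ℕ) (A : Set (EuclideanSpace ℝ (Fin d))) : ℝ :=
  (μH[(d : ℝ) - 1] (frontier A)).toReal

noncomputable def inradius (d : ℕ) (Ω : Set (EuclideanSpace ℝ (Fin d))) : ℝ :=
  sSup { r : ℝ | ∃ x, ball x r ⊆ Ω }

section HyperplaneProjection

variable {m : ℕ}

/-- The coordinates of a vector in an orthonormal basis, with the `k`-th coordinate removed. -/
noncomputable def removeCoord
    (b : OrthonormalBasis (Fin (m + 1)) ℝ (EuclideanSpace ℝ (Fin (m + 1)))) (k : Fin (m + 1)) :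
    EuclideanSpace ℝ (Fin (m + 1)) →L[ℝ] (Fin m → ℝ) :=
  ContinuousLinearMap.pi fun j => innerSL ℝ (b (k.succAbove j))

variable (b : OrthonormalBasis (Fin (m + 1)) ℝ (EuclideanSpace ℝ (Fin (m + 1))))
  (k : Fin (m + 1))

@[simp]
lemma removeCoord_apply (x : EuclideanSpace ℝ (Fin (m + 1))) (j : Fin m) :
    removeCoord b k x j = inner ℝ (b (k.succAbove j)) x := rfl

@[simp]
lemma removeCoord_self : removeCoord b k (b k) = 0 := by
  ext j
  simp [b.inner_eq_ite, Fin.succAbove_ne]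

lemma lipschitzWith_removeCoord : LipschitzWith 1 (removeCoord b k) := by
  refine AddMonoidHomClass.lipschitz_of_bound (removeCoord b k) 1 (fun x => ?_) |>.weaken (by simp)
  rw [one_mul, pi_norm_le_iff_of_nonneg (norm_nonneg _)]
  intro j
  simpa using norm_inner_le_norm (𝕜 := ℝ) (b (k.succAbove j)) x

lemma removeCoord_surjective : Function.Surjective (removeCoord b k) := by
  intro y
  refine ⟨∑ j, y j • b (k.succAbove j), ?_⟩
  ext j
  simp [inner_sum, inner_smul_right, b.inner_eq_ite]

lemma isOpenMap_removeCoord : IsOpenMap (removeCoord b k) :=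
  (removeCoord b k).isOpenMap (removeCoord_surjective b k)

lemma volume_removeCoord_image_le (A : Set (EuclideanSpace ℝ (Fin (m + 1)))) :
    volume (removeCoord b k '' A) ≤ μH[(m : ℝ)] A := by
  have h := (lipschitzWith_removeCoord b k).hausdorffMeasure_image_le (Nat.cast_nonneg m) A
  have h2 := hausdorffMeasure_pi_real (ι := Fin m)
  rw [Fintype.card_fin] at h2
  rw [h2] at h
  simpa using h

/-- A line meeting a bounded open set in direction `v` leaves it through its boundary. -/
lemma exists_add_smul_mem_frontier {E : Type*} [NormedAddCommGroup E] [NormedSpace ℝ E]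
    {Ω : Set E} (hΩ : IsOpen Ω) (hbdd : IsBounded Ω) {x v : E}
    (hx : x ∈ Ω) (hv : v ≠ 0) : ∃ t : ℝ, 0 < t ∧ x + t • v ∈ frontier Ω := by
  obtain ⟨R, hR⟩ := hbdd.subset_closedBall x
  have hv' : 0 < ‖v‖ := norm_pos_iff.2 hv
  set f : ℝ → E := fun t => x + t • v with hf
  have hfc : Continuous f := by fun_prop
  have hR0 : 0 ≤ R := by
    have := hR hx
    simpa using this
  set T := (R + 1) / ‖v‖ with hT
  have hT0 : 0 < T := by positivity
  have hout : f T ∉ Ω := by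
    intro h
    have := hR h
    rw [mem_closedBall, dist_eq_norm, hf] at this
    simp only [add_sub_cancel_left, norm_smul, Real.norm_eq_abs, abs_of_pos hT0] at this
    rw [hT, div_mul_cancel₀ _ hv'.ne'] at this
    linarith
  have hpre : IsPreconnected (f '' Icc 0 T) :=
    isPreconnected_Icc.image f hfc.continuousOn
  have h0 : f 0 = x := by simp [hf]
  obtain ⟨t, ht, hy⟩ : ∃ t ∈ Icc 0 T, f t ∈ frontier Ω := by
    by_contra! hno
    obtain ⟨y, -, hy, hy'⟩ := hpre Ω (closure Ω)ᶜ hΩ isClosed_closure.isOpen_compl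
      (by
        rintro _ ⟨t, ht, rfl⟩
        by_contra hcon
        simp only [mem_union, mem_compl_iff, not_or, not_not] at hcon
        exact hno t ht ⟨hcon.2, hΩ.interior_eq.symm ▸ hcon.1⟩)
      ⟨x, ⟨0, ⟨le_rfl, hT0.le⟩, h0⟩, hx⟩
      ⟨f T, ⟨T, ⟨hT0.le, le_rfl⟩, rfl⟩, fun h =>
        hno T ⟨hT0.le, le_rfl⟩ ⟨h, hΩ.interior_eq.symm ▸ hout⟩⟩
    exact hy' (subset_closure hy)
  refine ⟨t, lt_of_le_of_ne ht.1 ?_, hy⟩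
  rintro rfl
  rw [h0, frontier, hΩ.interior_eq] at hy
  exact hy.2 hx

/-- Each line through a convex body in a coordinate direction crosses the boundary at least twice,
so the boundary has at least twice the measure of the hyperplane projection. -/
lemma two_mul_volume_removeCoord_image_le {Ω : Set (EuclideanSpace ℝ (Fin (m + 1)))}
    (hΩ : IsOpen Ω) (hbdd : IsBounded Ω) (hconv : Convex ℝ Ω) :
    2 * volume (removeCoord b k '' Ω) ≤ μH[(m : ℝ)] (frontier Ω) := by
  set v := b k with hv
  have hv0 : v ≠ 0 := b.orthonormal.ne_zero k
  have key : ∀ w : EuclideanSpace ℝ (Fin (m + 1)), w ≠ 0 → removeCoord b k w = 0 →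
      volume (removeCoord b k '' Ω) ≤
        μH[(m : ℝ)] (frontier Ω ∩ ⋃ t ∈ Ioi (0 : ℝ), (fun x => x - t • w) ⁻¹' Ω) := by
    intro w hw hw0
    refine le_trans (measure_mono ?_) (volume_removeCoord_image_le b k _)
    rintro _ ⟨x, hx, rfl⟩
    obtain ⟨t, ht, hxt⟩ := exists_add_smul_mem_frontier hΩ hbdd hx hw
    refine ⟨x + t • w, ⟨hxt, ?_⟩, by simp [hw0]⟩
    simp only [mem_iUnion]
    exact ⟨t, ht, by simpa using hx⟩
  have hk1 := key v hv0 (removeCoord_self b k)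
  have hk2 := key (-v) (neg_ne_zero.2 hv0) (by rw [map_neg, removeCoord_self, neg_zero])
  rw [two_mul]
  refine (add_le_add hk1 hk2).trans ?_
  rw [← measure_union]
  · exact measure_mono (union_subset inter_subset_left inter_subset_left)
  · rw [Set.disjoint_left]
    rintro x ⟨hx, h1⟩ ⟨-, h2⟩
    simp only [mem_iUnion, mem_Ioi, mem_preimage] at h1 h2
    obtain ⟨s, hs, h1⟩ := h1
    obtain ⟨t, ht, h2⟩ := h2
    rw [frontier, hΩ.interior_eq] at hx
    apply hx.2
    have := hconv h1 h2 (a := t / (s + t)) (b := s / (s + t)) (by positivity) (by positivity)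
      (by field_simp; ring)
    convert this using 1
    match_scalars <;> field_simp <;> ring
  · refine isClosed_frontier.measurableSet.inter (IsOpen.measurableSet ?_)
    exact isOpen_biUnion fun t _ => hΩ.preimage (by fun_prop)

/-- A set of width at most `w` in the direction of a coordinate axis has volume at most `w` times
the volume of its projection along that axis. -/
lemma volume_le_mul_volume_removeCoord_image {Ω : Set (EuclideanSpace ℝ (Fin (m + 1)))}
    (hΩ : IsOpen Ω) {w : ℝ} (hw : ∀ x ∈ Ω, ∀ y ∈ Ω, inner ℝ (b k) (x - y) ≤ w) :
    volume Ω ≤ ENNReal.ofReal w * volume (removeCoord b k '' Ω) := by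
  rcases Ω.eq_empty_or_nonempty with rfl | ⟨x₀, hx₀⟩
  · simp
  set f := fun x : EuclideanSpace ℝ (Fin (m + 1)) => inner ℝ (b k) x with hf
  have hbb : BddBelow (f '' Ω) := by
    refine ⟨f x₀ - w, ?_⟩
    rintro _ ⟨y, hy, rfl⟩
    have := hw x₀ hx₀ y hy
    rw [inner_sub_right] at this
    simp only [hf]; linarith
  set a := sInf (f '' Ω) with ha
  have hlow : ∀ x ∈ Ω, a ≤ f x := fun x hx => csInf_le hbb ⟨x, hx, rfl⟩
  have hup : ∀ x ∈ Ω, f x ≤ a + w := by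
    intro x hx
    have : f x - w ≤ a := by
      refine le_csInf ⟨_, x, hx, rfl⟩ ?_
      rintro _ ⟨y, hy, rfl⟩
      have := hw x hx y hy
      rw [inner_sub_right] at this
      simp only [hf]; linarith
    linarith
  have hmp := ((volume_preserving_piFinSuccAbove (fun _ : Fin (m + 1) => ℝ) k).comp
    (EuclideanSpace.volume_preserving_symm_measurableEquiv_toLp (Fin (m + 1)))).comp
      b.measurePreserving_repr
  have hT : MeasurableSet (removeCoord b k '' Ω) :=
    (isOpenMap_removeCoord b k _ hΩ).measurableSet
  have hsub : Ω ⊆ ((⇑(MeasurableEquiv.piFinSuccAbove (fun _ : Fin (m + 1) => ℝ) k) ∘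
      ⇑(MeasurableEquiv.toLp 2 (Fin (m + 1) → ℝ)).symm) ∘ ⇑b.repr) ⁻¹'
        (Icc a (a + w) ×ˢ (removeCoord b k '' Ω)) := by
    intro x hx
    refine ⟨?_, x, hx, ?_⟩
    · simpa [f, b.repr_apply_apply] using And.intro (hlow x hx) (hup x hx)
    · ext j
      simp [b.repr_apply_apply, Fin.removeNth]
  calc volume Ω ≤ _ := measure_mono hsub
    _ = _ := hmp.measure_preimage (measurableSet_Icc.prod hT).nullMeasurableSet
    _ = _ := by rw [Measure.volume_eq_prod, Measure.prod_prod, Real.volume_Icc]; simp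

end HyperplaneProjection

section WidthDirections

variable {E : Type*} [NormedAddCommGroup E] [InnerProductSpace ℝ E] [FiniteDimensional ℝ E]

/-- Among the differences of points of a compact body `K`, one has the longest component
orthogonal to a given proper subspace `S`; that component spans the direction `e`. -/
lemma exists_longest_orthogonal_component {K : Set E} (hK : IsCompact K)
    (hint : (interior K).Nonempty) {S : Submodule ℝ E} (hS : S ≠ ⊤) :
    ∃ e p q : E, ‖e‖ = 1 ∧ e ∈ Sᗮ ∧ p ∈ K ∧ q ∈ K ∧ q - p ∈ S ⊔ Submodule.span ℝ {e} ∧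
      ∀ x ∈ K, ∀ y ∈ K, ‖Sᗮ.starProjection (x - y)‖ ≤ inner ℝ e (q - p) := by
  obtain ⟨x₀, hx₀⟩ := hint
  have hx₀K := interior_subset hx₀
  obtain ⟨⟨q, p⟩, ⟨hq, hp⟩, hmax⟩ := (hK.prod hK).exists_isMaxOn ⟨(x₀, x₀), hx₀K, hx₀K⟩
    (f := fun z : E × E => ‖Sᗮ.starProjection (z.1 - z.2)‖) (by fun_prop)
  have hmax' : ∀ x ∈ K, ∀ y ∈ K,
      ‖Sᗮ.starProjection (x - y)‖ ≤ ‖Sᗮ.starProjection (q - p)‖ :=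
    fun x hx y hy => hmax (show (x, y) ∈ K ×ˢ K from ⟨hx, hy⟩)
  set v := Sᗮ.starProjection (q - p) with hv
  have hvS : v ∈ Sᗮ := Submodule.starProjection_apply_mem _ _
  have hv0 : v ≠ 0 := by
    intro h0
    obtain ⟨g, hg, hg0⟩ := Submodule.exists_mem_ne_zero_of_ne_bot
      (mt Submodule.orthogonal_eq_bot_iff.1 hS)
    have hcont : Filter.Tendsto (fun t : ℝ => x₀ + t • g) (nhdsWithin 0 (Ioi 0)) (nhds x₀) := by
      have : Continuous fun t : ℝ => x₀ + t • g := by fun_prop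
      simpa using (this.tendsto 0).mono_left nhdsWithin_le_nhds
    obtain ⟨t, ht, ht0⟩ := ((hcont.eventually (mem_interior_iff_mem_nhds.1 hx₀)).and
      self_mem_nhdsWithin).exists
    have := hmax' _ ht _ hx₀K
    rw [h0, norm_zero, add_sub_cancel_left,
      Submodule.starProjection_eq_self_iff.2 (Sᗮ.smul_mem t hg)] at this
    have h := norm_le_zero_iff.1 this
    rcases smul_eq_zero.1 h with h | h
    · exact (ne_of_gt ht0) h
    · exact hg0 h
  have hvn : ‖v‖ ≠ 0 := norm_ne_zero_iff.2 hv0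
  have hdecomp : S.starProjection (q - p) + v = q - p :=
    Submodule.starProjection_add_starProjection_orthogonal (q - p)
  refine ⟨‖v‖⁻¹ • v, p, q, ?_, Sᗮ.smul_mem _ hvS, hp, hq, ?_, ?_⟩
  · rw [norm_smul, norm_inv, norm_norm, inv_mul_cancel₀ hvn]
  · rw [← hdecomp]
    refine Submodule.add_mem_sup (Submodule.starProjection_apply_mem _ _) ?_
    exact Submodule.mem_span_singleton.2 ⟨‖v‖, by rw [smul_smul, mul_inv_cancel₀ hvn, one_smul]⟩
  · intro x hx y hy
    refine (hmax' x hx y hy).trans (le_of_eq ?_)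
    rw [← hdecomp, inner_add_right, inner_smul_left, inner_smul_left,
      Submodule.inner_left_of_mem_orthogonal (Submodule.starProjection_apply_mem _ _) hvS,
      real_inner_self_eq_norm_sq]
    simp only [conj_trivial, mul_zero, zero_add]
    field_simp

/-- A compact body has an orthonormal basis of directions, the first of which is that of a
diameter, in each of which its width is attained by a pair of points; the differences of these
pairs form a triangular system. -/
lemma exists_orthonormalBasis_triangular_widths {m : ℕ} (hE : Module.finrank ℝ E = m + 1)
    {K : Set E} (hK : IsCompact K) (hint : (interior K).Nonempty) :
    ∃ (b : OrthonormalBasis (Fin (m + 1)) ℝ E) (p q : Fin (m + 1) → E),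
      (∀ i, p i ∈ K) ∧ (∀ i, q i ∈ K) ∧
      (∀ i j, i < j → inner ℝ (b j) (q i - p i) = 0) ∧
      (∀ i, ∀ x ∈ K, ∀ y ∈ K, inner ℝ (b i) (x - y) ≤ inner ℝ (b i) (q i - p i)) ∧
      ∀ x ∈ K, ∀ y ∈ K, ‖x - y‖ ≤ inner ℝ (b 0) (q 0 - p 0) := by
  have hstep : ∀ S : Submodule ℝ E, ∃ e p q : E, S ≠ ⊤ → ‖e‖ = 1 ∧ e ∈ Sᗮ ∧ p ∈ K ∧ q ∈ K ∧
      q - p ∈ S ⊔ Submodule.span ℝ {e} ∧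
      ∀ x ∈ K, ∀ y ∈ K, ‖Sᗮ.starProjection (x - y)‖ ≤ inner ℝ e (q - p) := by
    intro S
    by_cases hS : S = ⊤
    · exact ⟨0, 0, 0, fun h => absurd hS h⟩
    · obtain ⟨e, p, q, h⟩ := exists_longest_orthogonal_component hK hint hS
      exact ⟨e, p, q, fun _ => h⟩
  choose e p q hepq using hstep
  obtain ⟨S, hS0, hSs⟩ : ∃ S : ℕ → Submodule ℝ E, S 0 = ⊥ ∧
      ∀ n, S (n + 1) = S n ⊔ Submodule.span ℝ {e (S n)} :=
    ⟨Nat.rec ⊥ fun _ T => T ⊔ Submodule.span ℝ {e T}, rfl, fun _ => rfl⟩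
  have hmono : Monotone S := monotone_nat_of_le_succ fun n => by rw [hSs]; exact le_sup_left
  have hfin : ∀ n : ℕ, Module.finrank ℝ (S n) ≤ n := by
    intro n
    induction n with
    | zero => rw [hS0]; simp
    | succ n ih =>
      rw [hSs]
      refine (Submodule.finrank_add_le_finrank_add_finrank _ _).trans ?_
      exact add_le_add ih ((finrank_span_le_card {e (S n)}).trans (by simp))
  have htop : ∀ i : Fin (m + 1), S i ≠ ⊤ := by
    intro i h
    have := hfin i
    rw [h, finrank_top, hE] at this
    omega
  have hspec := fun i : Fin (m + 1) => hepq (S i) (htop i)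
  have hlt : ∀ i j : Fin (m + 1), i < j → S (i + 1) ≤ S j := fun i j hij =>
    hmono (Nat.succ_le_of_lt hij)
  have horth : Orthonormal ℝ fun i : Fin (m + 1) => e (S i) := by
    have hij : ∀ i j : Fin (m + 1), i < j → inner ℝ (e (S i)) (e (S j)) = 0 := by
      intro i j hij
      refine Submodule.inner_right_of_mem_orthogonal (K := S j) (hlt i j hij ?_) (hspec j).2.1
      rw [hSs]
      exact Submodule.mem_sup_right (Submodule.mem_span_singleton_self _)
    refine ⟨fun i => (hspec i).1, fun i j hne => ?_⟩
    rcases lt_or_gt_of_ne hne with h | h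
    · exact hij i j h
    · rw [real_inner_comm]; exact hij j i h
  have hcard : Fintype.card (Fin (m + 1)) = Module.finrank ℝ E := by simp [hE]
  let b : OrthonormalBasis (Fin (m + 1)) ℝ E :=
    (basisOfOrthonormalOfCardEqFinrank horth hcard).toOrthonormalBasis (by simpa using horth)
  have hb : ∀ i, b i = e (S i) := fun i => by simp [b]
  refine ⟨b, fun i => p (S i), fun i => q (S i), fun i => (hspec i).2.2.1,
    fun i => (hspec i).2.2.2.1, ?_, ?_, ?_⟩
  · intro i j hij
    rw [hb]
    refine Submodule.inner_left_of_mem_orthogonal (K := S j) (hlt i j hij ?_) (hspec j).2.1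
    rw [hSs]
    exact (hspec i).2.2.2.2.1
  · intro i x hx y hy
    rw [hb]
    refine le_trans ?_ ((hspec i).2.2.2.2.2 x hx y hy)
    have h1 : inner ℝ (e (S i)) (x - y) =
        inner ℝ (e (S i)) ((S i)ᗮ.starProjection (x - y)) := by
      rw [← Submodule.inner_starProjection_left_eq_right,
        Submodule.starProjection_eq_self_iff.2 (hspec i).2.1]
    rw [h1]
    refine (real_inner_le_norm _ _).trans ?_
    rw [(hspec i).1, one_mul]
  · intro x hx y hy
    rw [hb]
    have := (hspec 0).2.2.2.2.2 x hx y hy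
    rwa [Submodule.starProjection_eq_self_iff.2 (by simp [hS0])] at this

end WidthDirections

/-- A convex set contains the average of finitely many segments joining its points, hence a
parallelepiped. -/
lemma abs_det_le_pow_mul_volume {m : ℕ} {C : Set (Fin m → ℝ)} (hC : Convex ℝ C)
    {p q : Fin m → Fin m → ℝ} (hp : ∀ i, p i ∈ C) (hq : ∀ i, q i ∈ C) (hm : m ≠ 0) :
    ENNReal.ofReal |(Matrix.of fun i j => q i j - p i j).det| ≤ (m : ENNReal) ^ m * volume C := by
  have hm' : (m : ℝ) ≠ 0 := Nat.cast_ne_zero.2 hm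
  set M : Matrix (Fin m) (Fin m) ℝ := Matrix.of fun i j => q i j - p i j with hM
  set L := Matrix.toLin' ((m : ℝ)⁻¹ • M.transpose) with hL
  set c : Fin m → ℝ := ∑ i, (m : ℝ)⁻¹ • p i with hc
  have hsub : (fun z => c + z) '' (L '' Icc 0 1) ⊆ C := by
    rintro _ ⟨_, ⟨y, hy, rfl⟩, rfl⟩
    have hmem : ∑ i, (m : ℝ)⁻¹ • ((1 - y i) • p i + y i • q i) ∈ C := by
      refine hC.sum_mem (fun i _ => by positivity) (by simp [hm']) fun i _ => ?_
      exact hC (hp i) (hq i) (sub_nonneg.2 (hy.2 i)) (hy.1 i) (by ring)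
    convert hmem using 1
    ext j
    simp only [hc, hL, Pi.add_apply, Finset.sum_apply, Pi.smul_apply, smul_eq_mul,
      Matrix.toLin'_apply, Matrix.smul_mulVec, Matrix.mulVec, dotProduct, Matrix.transpose_apply,
      hM, Matrix.of_apply, Finset.mul_sum]
    rw [← Finset.sum_add_distrib]
    exact Finset.sum_congr rfl fun i _ => by ring
  have hvol := measure_mono (μ := volume) hsub
  rw [Set.image_add_left, measure_preimage_add, Measure.addHaar_image_linearMap, hL,
    LinearMap.det_toLin', Matrix.det_smul, Matrix.det_transpose, Real.volume_Icc_pi] at hvol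
  simp only [Pi.one_apply, Pi.zero_apply, sub_zero, ENNReal.ofReal_one, Finset.prod_const_one,
    mul_one, Fintype.card_fin] at hvol
  calc ENNReal.ofReal |M.det|
      = (m : ENNReal) ^ m * ENNReal.ofReal |(m : ℝ)⁻¹ ^ m * M.det| := by
        rw [← ENNReal.ofReal_natCast, ← ENNReal.ofReal_pow (by positivity),
          ← ENNReal.ofReal_mul (by positivity), abs_mul,
          abs_of_nonneg (show (0 : ℝ) ≤ (m : ℝ)⁻¹ ^ m by positivity),
          ← mul_assoc, ← mul_pow, mul_inv_cancel₀ hm', one_pow, one_mul]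
    _ ≤ _ := by gcongr

section Inradius

variable {E : Type*} [NormedAddCommGroup E] [InnerProductSpace ℝ E] [FiniteDimensional ℝ E]

/-- A convex body whose width is at least `(dim E + 1) * r` in all directions contains a ball of
radius `r`. -/
lemma exists_ball_subset_of_le_width {Ω : Set E} (hne : Ω.Nonempty) (hΩ : IsOpen Ω)
    (hbdd : IsBounded Ω) (hconv : Convex ℝ Ω) {r : ℝ} (hr : 0 ≤ r)
    (hw : ∀ u : E, ‖u‖ = 1 → ∃ y ∈ Ω, ∃ z ∈ Ω,
      (Module.finrank ℝ E + 1) * r ≤ inner ℝ u (y - z)) :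
    ∃ x, ball x r ⊆ Ω := by
  classical
  have hK : IsCompact (closure Ω) := hbdd.isCompact_closure
  have hKc : Convex ℝ (closure Ω) := hconv.closure
  have hKne : (closure Ω).Nonempty := hne.closure
  have hmax : ∀ u : sphere (0 : E) 1, ∃ y ∈ closure Ω, ∀ x ∈ closure Ω,
      inner ℝ (u : E) x ≤ inner ℝ (u : E) y := fun u => by
    obtain ⟨y, hy, h⟩ := hK.exists_isMaxOn hKne (f := fun x => inner ℝ (u : E) x) (by fun_prop)
    exact ⟨y, hy, fun x hx => h hx⟩
  choose top htop hle using hmax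
  have hlow : ∀ u : sphere (0 : E) 1, ∃ z ∈ closure Ω,
      inner ℝ (u : E) z + (Module.finrank ℝ E + 1) * r ≤ inner ℝ (u : E) (top u) := fun u => by
    obtain ⟨y, hy, z, hz, h⟩ := hw u (by simp)
    refine ⟨z, subset_closure hz, ?_⟩
    rw [inner_sub_right] at h
    have := hle u y (subset_closure hy)
    linarith
  choose bot hbot hbot_le using hlow
  let F : sphere (0 : E) 1 → Set E := fun u =>
    closure Ω ∩ {x | inner ℝ (u : E) x ≤ inner ℝ (u : E) (top u) - r}
  have hF : (⋂ u, F u).Nonempty := by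
    rcases isEmpty_or_nonempty (sphere (0 : E) 1) with h | h
    · simp
    refine Convex.helly_theorem_compact' (𝕜 := ℝ) ?_ ?_ ?_
    · exact fun u => hKc.inter (convex_halfSpace_le (innerₗ E (u : E)).isLinear _)
    · exact fun u => hK.inter_right (isClosed_le (by fun_prop) (by fun_prop))
    · intro I hI
      rcases I.eq_empty_or_nonempty with rfl | hIne
      · simp
      have hk : (0 : ℝ) < I.card := by exact_mod_cast hIne.card_pos
      have hkd : (I.card : ℝ) ≤ Module.finrank ℝ E + 1 := by exact_mod_cast hI
      refine ⟨∑ i ∈ I, (I.card : ℝ)⁻¹ • bot i, ?_⟩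
      simp only [mem_iInter]
      intro u hu
      refine ⟨hKc.sum_mem (fun _ _ => by positivity) (by simp [hk.ne']) fun i _ => hbot i, ?_⟩
      simp only [mem_ofPred_eq, inner_sum, inner_smul_right, ← Finset.mul_sum]
      have hsum : ∑ i ∈ I, inner ℝ (u : E) (bot i) + (Module.finrank ℝ E + 1) * r ≤
          I.card * inner ℝ (u : E) (top u) := by
        rw [← Finset.add_sum_erase I _ hu]
        have h1 : ∑ i ∈ I.erase u, inner ℝ (u : E) (bot i) ≤
            ∑ i ∈ I.erase u, inner ℝ (u : E) (top u) :=
          Finset.sum_le_sum fun i _ => hle u _ (hbot i)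
        have h2 := hbot_le u
        have h3 := Finset.add_sum_erase I (fun _ => inner ℝ (u : E) (top u)) hu
        simp only [Finset.sum_const, nsmul_eq_mul] at h1 h3
        linarith
      have h4 := mul_le_mul_of_nonneg_right hkd hr
      rw [inv_mul_le_iff₀ hk]
      linarith
  obtain ⟨c, hc⟩ := hF
  rw [mem_iInter] at hc
  refine ⟨c, ?_⟩
  have hball : ball c r ⊆ closure Ω := by
    intro z hz
    by_contra hzK
    obtain ⟨f, s, hfs, hsz⟩ := geometric_hahn_banach_closed_point hKc isClosed_closure hzK
    set v := (InnerProductSpace.toDual ℝ E).symm f with hv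
    have hfv : ∀ x, f x = inner ℝ v x := fun x => by
      rw [hv, InnerProductSpace.toDual_symm_apply]
    have hv0 : v ≠ 0 := by
      intro h
      obtain ⟨a, ha⟩ := hKne
      have h1 := hfs a ha
      simp only [hfv, h, inner_zero_left] at h1 hsz
      linarith
    have hvn : 0 < ‖v‖ := norm_pos_iff.2 hv0
    let u : sphere (0 : E) 1 := ⟨‖v‖⁻¹ • v, by
      rw [mem_sphere_zero_iff_norm, norm_smul, norm_inv, norm_norm, inv_mul_cancel₀ hvn.ne']⟩
    have hu : ∀ x, inner ℝ (u : E) x = ‖v‖⁻¹ * f x := fun x => by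
      simp [u, inner_smul_left, hfv]
    have h1 : inner ℝ (u : E) (top u) < inner ℝ (u : E) z := by
      rw [hu, hu]
      exact mul_lt_mul_of_pos_left ((hfs _ (htop u)).trans hsz) (inv_pos.2 hvn)
    have h2 : inner ℝ (u : E) c ≤ inner ℝ (u : E) (top u) - r := (hc u).2
    have h3 := real_inner_le_norm (u : E) (z - c)
    rw [inner_sub_right, norm_eq_of_mem_sphere u, one_mul, ← dist_eq_norm] at h3
    have h4 := mem_ball.1 hz
    linarith
  calc ball c r ⊆ interior (closure Ω) := interior_maximal hball isOpen_ball
    _ = Ω := by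
      rw [hconv.interior_closure_eq_interior_of_nonempty_interior
        (by rwa [hΩ.interior_eq]), hΩ.interior_eq]

end Inradius

section Euclidean

variable {m : ℕ}

lemma le_inradius {d : ℕ} (hd : d ≠ 0) {Ω : Set (EuclideanSpace ℝ (Fin d))}
    (hbdd : IsBounded Ω) {x : EuclideanSpace ℝ (Fin d)} {r : ℝ} (h : ball x r ⊆ Ω) :
    r ≤ inradius d Ω := by
  have : Nonempty (Fin d) := Fin.pos_iff_nonempty.1 (Nat.pos_of_ne_zero hd)
  refine le_csSup ⟨diam Ω, ?_⟩ ⟨x, h⟩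
  rintro s ⟨y, hy⟩
  rcases le_or_gt s 0 with hs | hs
  · exact hs.trans diam_nonneg
  · have h1 := diam_mono hy hbdd
    have h2 := diam_ball_eq y hs.le
    linarith

lemma two_mul_volume_le_mul {Ω : Set (EuclideanSpace ℝ (Fin (m + 1)))}
    (hΩ : IsOpen Ω) (hbdd : IsBounded Ω) (hconv : Convex ℝ Ω)
    (hP : μH[(m : ℝ)] (frontier Ω) ≠ ⊤)
    (b : OrthonormalBasis (Fin (m + 1)) ℝ (EuclideanSpace ℝ (Fin (m + 1)))) (k : Fin (m + 1))
    {w : ℝ} (hw0 : 0 ≤ w) (hw : ∀ x ∈ Ω, ∀ y ∈ Ω, inner ℝ (b k) (x - y) ≤ w) :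
    2 * (volume Ω).toReal ≤ w * (μH[(m : ℝ)] (frontier Ω)).toReal := by
  have h : 2 * volume Ω ≤ ENNReal.ofReal w * μH[(m : ℝ)] (frontier Ω) :=
    calc 2 * volume Ω ≤ 2 * (ENNReal.ofReal w * volume (removeCoord b k '' Ω)) := by
          gcongr; exact volume_le_mul_volume_removeCoord_image b k hΩ hw
      _ = ENNReal.ofReal w * (2 * volume (removeCoord b k '' Ω)) := by ring
      _ ≤ _ := by gcongr; exact two_mul_volume_removeCoord_image_le b k hΩ hbdd hconv
  have := ENNReal.toReal_mono (ENNReal.mul_ne_top ENNReal.ofReal_ne_top hP) h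
  simpa [ENNReal.toReal_ofReal hw0] using this

/-- The volume of a convex body is controlled by its inradius and the measure of its boundary. -/
lemma two_mul_volume_le_inradius_mul {Ω : Set (EuclideanSpace ℝ (Fin (m + 1)))}
    (hne : Ω.Nonempty) (hΩ : IsOpen Ω) (hbdd : IsBounded Ω) (hconv : Convex ℝ Ω)
    (hP : μH[(m : ℝ)] (frontier Ω) ≠ ⊤) :
    2 * (volume Ω).toReal ≤
      (m + 2) * inradius (m + 1) Ω * (μH[(m : ℝ)] (frontier Ω)).toReal := by
  set P := (μH[(m : ℝ)] (frontier Ω)).toReal with hPdef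
  obtain ⟨x, hx⟩ := hne
  have hρ : 0 ≤ inradius (m + 1) Ω := le_inradius m.succ_ne_zero hbdd (x := x) (by simp)
  have key : ∀ r, inradius (m + 1) Ω < r → 2 * (volume Ω).toReal ≤ (m + 2) * r * P := by
    intro r hr
    obtain ⟨u, hu, hw⟩ : ∃ u : EuclideanSpace ℝ (Fin (m + 1)), ‖u‖ = 1 ∧
        ∀ y ∈ Ω, ∀ z ∈ Ω, inner ℝ u (y - z) ≤ (m + 2) * r := by
      by_contra! hno
      obtain ⟨c, hc⟩ := exists_ball_subset_of_le_width ⟨x, hx⟩ hΩ hbdd hconv (hρ.trans hr.le)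
        (fun u hu => by
          obtain ⟨y, hy, z, hz, h⟩ := hno u hu
          refine ⟨y, hy, z, hz, le_trans (le_of_eq ?_) h.le⟩
          rw [finrank_euclideanSpace_fin]
          push_cast
          ring)
      exact absurd (le_inradius m.succ_ne_zero hbdd hc) (not_le.2 hr)
    obtain ⟨b, hb⟩ := Orthonormal.exists_orthonormalBasis_extension_of_card_eq
      (𝕜 := ℝ) (E := EuclideanSpace ℝ (Fin (m + 1))) (ι := Fin (m + 1)) (by simp)
      (v := fun _ => u) (s := {0}) ⟨fun _ => hu, fun i j hij => absurd (Subsingleton.elim i j) hij⟩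
    refine two_mul_volume_le_mul hΩ hbdd hconv hP b 0
      (mul_nonneg (by positivity) (hρ.trans hr.le)) ?_
    rwa [hb 0 rfl]
  refine ge_of_tendsto (x := nhdsWithin (inradius (m + 1) Ω) (Ioi (inradius (m + 1) Ω)))
    (f := fun r => (m + 2) * r * P) ?_ ?_
  · have : Continuous fun r : ℝ => (m + 2) * r * P := by fun_prop
    exact (this.tendsto _).mono_left nhdsWithin_le_nhds
  · exact eventually_nhdsWithin_of_forall key

/-- The diameter of a convex body is controlled by its volume and the measure of its boundary. -/
lemma volume_pow_mul_diam_le {n : ℕ} {Ω : Set (EuclideanSpace ℝ (Fin (n + 2)))}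
    (hne : Ω.Nonempty) (hΩ : IsOpen Ω) (hbdd : IsBounded Ω) (hconv : Convex ℝ Ω)
    (hP : μH[((n + 1 : ℕ) : ℝ)] (frontier Ω) ≠ ⊤) :
    (volume Ω).toReal ^ n * diam Ω ≤
      (n + 1) ^ (n + 1) * ((μH[((n + 1 : ℕ) : ℝ)] (frontier Ω)).toReal / 2) ^ (n + 1) := by
  set P := (μH[((n + 1 : ℕ) : ℝ)] (frontier Ω)).toReal with hPdef
  have hP0 : 0 ≤ P := ENNReal.toReal_nonneg
  obtain ⟨b, p, q, hp, hq, htri, hwidth, hdiam⟩ := exists_orthonormalBasis_triangular_widths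
    (m := n + 1) (by simp) hbdd.isCompact_closure
    (hne.mono (interior_maximal subset_closure hΩ))
  set w : Fin (n + 2) → ℝ := fun i => inner ℝ (b i) (q i - p i) with hw
  have hw0 : ∀ i, 0 ≤ w i := fun i => by
    simpa using hwidth i (p i) (hp i) (p i) (hp i)
  have hV : ∀ i, (volume Ω).toReal ≤ w i * (P / 2) := fun i => by
    have := two_mul_volume_le_mul hΩ hbdd hconv hP b i (hw0 i)
      (fun x hx y hy => hwidth i x (subset_closure hx) y (subset_closure hy))
    linarith
  have hD : diam Ω ≤ w 0 := diam_le_of_forall_dist_le (hw0 0) fun x hx y hy => by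
    rw [dist_eq_norm]
    exact hdiam x (subset_closure hx) y (subset_closure hy)
  have hprod : ∏ j : Fin (n + 1), w j.castSucc ≤ (n + 1) ^ (n + 1) * (P / 2) := by
    set T := removeCoord b (Fin.last (n + 1)) with hT
    have hTconv : Convex ℝ (T '' Ω) := hconv.linear_image T.toLinearMap
    have hTmem : ∀ x ∈ closure Ω, T x ∈ closure (T '' Ω) := fun x hx =>
      image_closure_subset_closure_image T.continuous ⟨x, hx, rfl⟩
    have hdet := abs_det_le_pow_mul_volume hTconv.closure (p := fun i => T (p i.castSucc))
      (q := fun i => T (q i.castSucc)) (fun i => hTmem _ (hp _)) (fun i => hTmem _ (hq _))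
      n.succ_ne_zero
    rw [Matrix.det_of_isLowerTriangular, measure_closure_of_null_frontier
      (hTconv.addHaar_frontier volume)] at hdet
    · have h2 := two_mul_volume_removeCoord_image_le b (Fin.last (n + 1)) hΩ hbdd hconv
      have h3 : 2 * ENNReal.ofReal |∏ j : Fin (n + 1), w j.castSucc| ≤
          ((n + 1 : ℕ) : ENNReal) ^ (n + 1) * μH[((n + 1 : ℕ) : ℝ)] (frontier Ω) := by
        calc _ ≤ 2 * (((n + 1 : ℕ) : ENNReal) ^ (n + 1) * volume (T '' Ω)) := by
              gcongr
              simpa [hT, hw, inner_sub_right] using hdet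
          _ = ((n + 1 : ℕ) : ENNReal) ^ (n + 1) * (2 * volume (T '' Ω)) := by ring
          _ ≤ _ := by gcongr
      have h4 := ENNReal.toReal_mono (ENNReal.mul_ne_top (by simp) hP) h3
      rw [abs_of_nonneg (Finset.prod_nonneg fun i _ => hw0 _)] at h4
      rw [ENNReal.toReal_mul, ENNReal.toReal_mul, ENNReal.toReal_pow, ENNReal.toReal_natCast,
        ENNReal.toReal_ofReal (Finset.prod_nonneg fun i _ => hw0 _)] at h4
      simp only [ENNReal.toReal_ofNat] at h4
      push_cast at h4 hPdef ⊢
      rw [← hPdef] at h4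
      linarith
    · intro i j hij
      have := htri i.castSucc j.castSucc (by simpa using hij)
      simpa [hT, inner_sub_right] using this
  calc (volume Ω).toReal ^ n * diam Ω
      = (∏ _i : Fin n, (volume Ω).toReal) * diam Ω := by simp
    _ ≤ (∏ i : Fin n, w i.succ.castSucc * (P / 2)) * w 0 := by
        gcongr with i
        · exact Finset.prod_nonneg fun i _ => mul_nonneg (hw0 _) (by positivity)
        · exact hV _
    _ = (∏ j : Fin (n + 1), w j.castSucc) * (P / 2) ^ n := by
        rw [Fin.prod_univ_succ, Finset.prod_mul_distrib]
        simp only [Finset.prod_const, Finset.card_univ, Fintype.card_fin, Fin.castSucc_zero,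
          Fin.castSucc_succ]
        ring
    _ ≤ (n + 1) ^ (n + 1) * (P / 2) * (P / 2) ^ n := by gcongr
    _ = _ := by ring

end Euclidean

lemma sqrt_pi_pow_div_Gamma_mul_le (d : ℕ) :
    √Real.pi ^ d / Real.Gamma (d / 2 + 1) * (d + 1) ≤ 2 ^ (d + 2) := by
  have hrec : ∀ k : ℕ, √Real.pi ^ (k + 2) / Real.Gamma ((k + 2 : ℕ) / 2 + 1) =
      √Real.pi ^ k / Real.Gamma (k / 2 + 1) * (Real.pi / (k / 2 + 1)) := by
    intro k
    have h : (((k + 2 : ℕ) : ℝ) / 2 + 1) = (k / 2 + 1 : ℝ) + 1 := by push_cast; ring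
    rw [h, Real.Gamma_add_one (by positivity), pow_add, Real.sq_sqrt Real.pi_nonneg]
    field_simp
  have hpi := Real.pi_lt_d2
  have h0 : √Real.pi ^ 0 / Real.Gamma ((0 : ℕ) / 2 + 1) = 1 := by simp
  have h1 : √Real.pi ^ 1 / Real.Gamma ((1 : ℕ) / 2 + 1) = 2 := by
    have : ((1 : ℕ) : ℝ) / 2 + 1 = 1 / 2 + 1 := by norm_num
    rw [this, Real.Gamma_add_one (by norm_num), Real.Gamma_one_half_eq]
    have := Real.sqrt_pos.2 Real.pi_pos
    field_simp
  induction d using Nat.strong_induction_on with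
  | _ d ih =>
    match d with
    | 0 => rw [h0]; norm_num
    | 1 => rw [h1]; norm_num
    | 2 => rw [hrec 0, h0]; norm_num; linarith
    | 3 => rw [hrec 1, h1]; norm_num; linarith
    | k + 4 =>
      have ihk := ih (k + 2) (by omega)
      rw [hrec (k + 2)]
      set a := √Real.pi ^ (k + 2) / Real.Gamma ((k + 2 : ℕ) / 2 + 1)
      have ha : 0 ≤ a := div_nonneg (by positivity) (Real.Gamma_pos_of_pos (by positivity)).le
      have hfac : Real.pi / (((k + 2 : ℕ) : ℝ) / 2 + 1) * (((k + 2 + 2 : ℕ) : ℝ) + 1) ≤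
          4 * (((k + 2 : ℕ) : ℝ) + 1) := by
        rw [div_mul_eq_mul_div, div_le_iff₀ (by positivity)]
        push_cast
        have hk : (0 : ℝ) ≤ k := k.cast_nonneg
        nlinarith
      calc a * (Real.pi / (((k + 2 : ℕ) : ℝ) / 2 + 1)) * (((k + 2 + 2 : ℕ) : ℝ) + 1)
          = a * (Real.pi / (((k + 2 : ℕ) : ℝ) / 2 + 1) * (((k + 2 + 2 : ℕ) : ℝ) + 1)) := by ring
        _ ≤ a * (4 * (((k + 2 : ℕ) : ℝ) + 1)) := by gcongr
        _ = 4 * (a * (((k + 2 : ℕ) : ℝ) + 1)) := by ring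
        _ ≤ 4 * 2 ^ (k + 2 + 2) := by gcongr
        _ = 2 ^ (k + 2 + 2 + 2) := by ring

lemma volume_unit_ball_mul_le {d : ℕ} (hd : d ≠ 0) :
    (volume (ball (0 : EuclideanSpace ℝ (Fin d)) 1)).toReal * (d + 1) ≤ 2 ^ (d + 2) := by
  have : Nonempty (Fin d) := Fin.pos_iff_nonempty.1 (Nat.pos_of_ne_zero hd)
  rw [EuclideanSpace.volume_ball, Fintype.card_fin, ENNReal.ofReal_one, one_pow, one_mul,
    ENNReal.toReal_ofReal
      (div_nonneg (by positivity) (Real.Gamma_pos_of_pos (by positivity)).le)]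
  exact sqrt_pi_pow_div_Gamma_mul_le d

lemma two_mul_pow_self_le (k : ℕ) : 2 * ((k : ℝ) + 1) ^ (k + 1) ≤ (k + 2) ^ (k + 1) := by
  have hk : (0 : ℝ) < k + 1 := by positivity
  have h := one_add_mul_le_pow (a := ((k : ℝ) + 1)⁻¹)
    (by have := inv_pos.2 hk; linarith) (k + 1)
  push_cast at h
  rw [mul_inv_cancel₀ hk.ne'] at h
  calc 2 * ((k : ℝ) + 1) ^ (k + 1)
      ≤ (1 + ((k : ℝ) + 1)⁻¹) ^ (k + 1) * (k + 1) ^ (k + 1) := by gcongr; linarith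
    _ = _ := by
      rw [← mul_pow, add_mul, inv_mul_cancel₀ hk.ne']
      ring

theorem measure_perim_le_inradius_diam (d : ℕ) (hd : 2 ≤ d)
    (Ω : Set (EuclideanSpace ℝ (Fin d))) (hne : Ω.Nonempty) (hΩ : IsOpen Ω)
    (hbdd : IsBounded Ω) (hconv : Convex ℝ Ω) :
    (volume Ω).toReal ^ (((d : ℝ) - 1) / d) / perim d Ω ≤
      ((d : ℝ) ^ (((d : ℝ) - 1) / d) /
          (volume (ball (0 : EuclideanSpace ℝ (Fin d)) 1)).toReal ^ ((1 : ℝ) / d)) *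
        (2 * inradius d Ω / diam Ω) ^ ((1 : ℝ) / d) := by
  obtain ⟨n, rfl⟩ : ∃ n, d = n + 2 := ⟨d - 2, by omega⟩
  have hcast : ((n + 2 : ℕ) : ℝ) - 1 = ((n + 1 : ℕ) : ℝ) := by push_cast; ring
  set P := perim (n + 2) Ω with hPdef
  set V := (volume Ω).toReal with hVdef
  set ρ := inradius (n + 2) Ω with hρdef
  set ω := (volume (ball (0 : EuclideanSpace ℝ (Fin (n + 2))) 1)).toReal with hωdef
  have hV0 : 0 ≤ V := ENNReal.toReal_nonneg
  obtain ⟨x, hx⟩ := hne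
  have hρ : 0 ≤ ρ := le_inradius (n + 1).succ_ne_zero hbdd (x := x) (by simp)
  have hω : 0 < ω := ENNReal.toReal_pos (measure_ball_pos _ _ one_pos).ne' measure_ball_lt_top.ne
  have hD : 0 < diam Ω := by
    obtain ⟨r, hr, hball⟩ := Metric.isOpen_iff.1 hΩ x hx
    have h1 := diam_mono hball hbdd
    rw [diam_ball_eq x hr.le] at h1
    linarith
  have hP0 : 0 ≤ P := ENNReal.toReal_nonneg
  rcases hP0.eq_or_lt with hP | hP
  · rw [← hP, div_zero]
    positivity
  have hPeq : P = (μH[((n + 1 : ℕ) : ℝ)] (frontier Ω)).toReal := by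
    rw [hPdef, perim, hcast]
  have hPtop : μH[((n + 1 : ℕ) : ℝ)] (frontier Ω) ≠ ⊤ := fun h => by
    rw [h, ENNReal.toReal_top] at hPeq
    exact hP.ne' hPeq
  have hvol := two_mul_volume_le_inradius_mul ⟨x, hx⟩ hΩ hbdd hconv hPtop
  have hdiam := volume_pow_mul_diam_le ⟨x, hx⟩ hΩ hbdd hconv hPtop
  rw [← hPeq] at hvol hdiam
  have hball := volume_unit_ball_mul_le (n + 1).succ_ne_zero
  have hpow := two_mul_pow_self_le n
  change 2 * V ≤ (((n + 1 : ℕ) : ℝ) + 2) * ρ * P at hvol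
  change ω * (((n + 2 : ℕ) : ℝ) + 1) ≤ _ at hball
  change V ^ n * diam Ω ≤ _ at hdiam
  have hmain : V ^ (n + 1) * (ω * diam Ω) ≤ ((n + 2 : ℕ) : ℝ) ^ (n + 1) * (2 * ρ) * P ^ (n + 2) :=
    calc V ^ (n + 1) * (ω * diam Ω)
        = ω * V * (V ^ n * diam Ω) := by ring
      _ ≤ ω * ((((n + 1 : ℕ) : ℝ) + 2) * ρ * P / 2) *
            ((n + 1) ^ (n + 1) * (P / 2) ^ (n + 1)) := by
          gcongr
          linarith
      _ = (ω * (((n + 2 : ℕ) : ℝ) + 1)) * (ρ * (n + 1) ^ (n + 1) * (P / 2) ^ (n + 2)) := by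
          push_cast; ring
      _ ≤ 2 ^ (n + 2 + 2) * (ρ * (n + 1) ^ (n + 1) * (P / 2) ^ (n + 2)) := by gcongr
      _ = 2 * ρ * (2 * ((n : ℝ) + 1) ^ (n + 1)) * P ^ (n + 2) := by
          rw [div_pow, pow_add 2 (n + 2) 2]
          field_simp
      _ ≤ 2 * ρ * (n + 2) ^ (n + 1) * P ^ (n + 2) := by gcongr
      _ = _ := by push_cast; ring
  have hd0 : ((n + 2 : ℕ) : ℝ) ≠ 0 := by positivity
  have hroot : ∀ a : ℝ, 0 ≤ a → a ^ ((((n + 2 : ℕ) : ℝ) - 1) / ((n + 2 : ℕ) : ℝ)) =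
      (a ^ (n + 1)) ^ ((1 : ℝ) / ((n + 2 : ℕ) : ℝ)) := fun a ha => by
    rw [hcast, ← Real.rpow_natCast a (n + 1), ← Real.rpow_mul ha, mul_one_div]
  have hProot : P = (P ^ (n + 2)) ^ ((1 : ℝ) / ((n + 2 : ℕ) : ℝ)) := by
    rw [one_div, Real.pow_rpow_inv_natCast hP.le (by omega)]
  rw [hroot V hV0, hroot _ (Nat.cast_nonneg _)]
  nth_rewrite 1 [hProot]
  rw [← Real.div_rpow (by positivity) (by positivity), ← Real.div_rpow (by positivity) hω.le,
    ← Real.mul_rpow (by positivity) (by positivity)]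
  refine Real.rpow_le_rpow (by positivity) ?_ (by positivity)
  rw [div_mul_div_comm, div_le_div_iff₀ (by positivity) (by positivity)]
  exact hmain
end

section
/- For a nonempty open bounded convex set Ω ⊂ R^d, d≥2: diam(Ω) ≤ (2 d^{d-1}/ω_d) · P(Ω)^{d-1} / |Ω|^{d-2}. -/
open MeasureTheory Metric Set Bornology Pointwise

open scoped ENNReal

namespace ConvexDiam

theorem isLinearMap_removeNth {n : ℕ} (j : Fin (n + 1)) :
    IsLinearMap ℝ (j.removeNth : (Fin (n + 1) → ℝ) → Fin n → ℝ) :=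
  ⟨fun _ _ => rfl, fun _ _ => rfl⟩

theorem isOpenMap_removeNth {n : ℕ} (j : Fin (n + 1)) :
    IsOpenMap (j.removeNth : (Fin (n + 1) → ℝ) → Fin n → ℝ) :=
  (isLinearMap_removeNth j).mk'.isOpenMap_of_finiteDimensional fun y =>
    ⟨j.insertNth (0 : ℝ) y, Fin.removeNth_insertNth (α := fun _ => ℝ) j 0 y⟩

theorem removeNth_succ_cons {n : ℕ} (j : Fin (n + 1)) (t : ℝ) (y : Fin (n + 1) → ℝ) :
    j.succ.removeNth (Fin.cons t y : Fin (n + 2) → ℝ) =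
      (Fin.cons t (j.removeNth y) : Fin (n + 1) → ℝ) := by
  ext i
  refine Fin.cases ?_ (fun i => ?_) i <;> simp [Fin.removeNth]

theorem removeNth_zero_removeNth_succ {n : ℕ} (j : Fin (n + 1)) (x : Fin (n + 2) → ℝ) :
    (0 : Fin (n + 1)).removeNth (j.succ.removeNth x) =
      j.removeNth ((0 : Fin (n + 2)).removeNth x) := by
  ext i
  simp [Fin.removeNth]

theorem continuous_cons {n : ℕ} :
    Continuous fun q : ℝ × (Fin n → ℝ) => (Fin.cons q.1 q.2 : Fin (n + 1) → ℝ) :=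
  continuous_pi fun i => by
    refine Fin.cases ?_ (fun i => ?_) i
    · simpa using continuous_fst
    · simp only [Fin.cons_succ]
      fun_prop

theorem volume_eq_volume_prod {n : ℕ} {S : Set (Fin (n + 1) → ℝ)} (hS : MeasurableSet S) :
    volume S = (volume : Measure ℝ).prod (volume : Measure (Fin n → ℝ))
      {q | (Fin.cons q.1 q.2 : Fin (n + 1) → ℝ) ∈ S} := by
  have h := (volume_preserving_piFinSuccAbove (fun _ : Fin (n + 1) => ℝ) 0).symm
  rw [← h.measure_preimage hS.nullMeasurableSet]
  congr 1
  ext q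
  simp
  rfl

theorem volume_eq_lintegral_head {n : ℕ} {S : Set (Fin (n + 1) → ℝ)} (hS : MeasurableSet S) :
    volume S = ∫⁻ t : ℝ, volume {y : Fin n → ℝ | (Fin.cons t y : Fin (n + 1) → ℝ) ∈ S} := by
  rw [volume_eq_volume_prod hS]
  exact Measure.prod_apply (continuous_cons.measurable hS)

theorem volume_eq_lintegral_tail {n : ℕ} {S : Set (Fin (n + 1) → ℝ)} (hS : MeasurableSet S) :
    volume S = ∫⁻ y : Fin n → ℝ, volume {t : ℝ | (Fin.cons t y : Fin (n + 1) → ℝ) ∈ S} := by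
  rw [volume_eq_volume_prod hS]
  exact Measure.prod_apply_symm (continuous_cons.measurable hS)

theorem measurable_volume_slice {n : ℕ} {S : Set (Fin (n + 1) → ℝ)} (hS : MeasurableSet S) :
    Measurable fun t : ℝ => volume {y : Fin n → ℝ | (Fin.cons t y : Fin (n + 1) → ℝ) ∈ S} :=
  measurable_measure_prodMk_left (continuous_cons.measurable hS)

/-- The **Loomis–Whitney inequality** for open sets. -/
theorem volume_pow_le_prod_volume_removeNth (k : ℕ) (S : Set (Fin (k + 1) → ℝ)) (hS : IsOpen S)
    (hne : S.Nonempty) : volume S ^ k ≤ ∏ j : Fin (k + 1), volume (j.removeNth '' S) := by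
  induction k with
  | zero =>
    obtain ⟨x, hx⟩ := hne
    have : (Fin.removeNth 0 '' S : Set (Fin 0 → ℝ)) = Set.univ :=
      Set.eq_univ_of_forall fun y => ⟨x, hx, Subsingleton.elim _ _⟩
    refine le_trans ?_ (Fin.prod_univ_one fun j : Fin 1 => volume (j.removeNth '' S)).ge
    rw [this]
    simp [volume_pi]
  | succ k ih =>
    set slice : ℝ → Set (Fin (k + 1) → ℝ) := fun t =>
      {y | (Fin.cons t y : Fin (k + 2) → ℝ) ∈ S} with hslice
    set g : Fin (k + 1) → ℝ → ℝ≥0∞ := fun j t =>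
      volume {z : Fin k → ℝ | (Fin.cons t z : Fin (k + 1) → ℝ) ∈ j.succ.removeNth '' S} with hg
    have hopen : ∀ j : Fin (k + 2), MeasurableSet (j.removeNth '' S) := fun j =>
      (isOpenMap_removeNth j S hS).measurableSet
    set A := volume ((0 : Fin (k + 2)).removeNth '' S) with hA
    have hle : ∀ t, volume (slice t) ^ (k + 1) ≤ A * ∏ j, g j t := by
      intro t
      rcases (slice t).eq_empty_or_nonempty with h0 | hn
      · simp [h0]
      · rw [pow_succ']
        refine mul_le_mul' (measure_mono fun y hy => ⟨_, hy, ?_⟩)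
          ((ih (slice t) (hS.preimage (continuous_cons.comp (Continuous.prodMk_right t))) hn).trans
            (Finset.prod_le_prod' fun j _ => measure_mono ?_))
        · simp [Fin.removeNth_zero]
        · rintro _ ⟨y, hy, rfl⟩
          exact ⟨_, hy, removeNth_succ_cons j t y⟩
    have hk : (0 : ℝ) < ((k + 1 : ℕ) : ℝ) := by positivity
    set p : ℝ := ((k + 1 : ℕ) : ℝ)⁻¹ with hp
    have hp0 : 0 ≤ p := by positivity
    have hroot : ∀ x : ℝ≥0∞, (x ^ (k + 1)) ^ p = x := fun x => by
      rw [← ENNReal.rpow_natCast, ← ENNReal.rpow_mul, hp, mul_inv_cancel₀ hk.ne', ENNReal.rpow_one]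
    have hpow : ∀ x : ℝ≥0∞, (x ^ p) ^ (k + 1) = x := fun x => by
      rw [← ENNReal.rpow_natCast, ← ENNReal.rpow_mul, hp, inv_mul_cancel₀ hk.ne', ENNReal.rpow_one]
    have hmeas : ∀ j, Measurable (g j) := fun j => measurable_volume_slice (hopen j.succ)
    have key : volume S ≤ A ^ p * ∏ j : Fin (k + 1), volume (j.succ.removeNth '' S) ^ p :=
      calc volume S = ∫⁻ t, volume (slice t) := volume_eq_lintegral_head hS.measurableSet
        _ ≤ ∫⁻ t, A ^ p * ∏ j, g j t ^ p := by
          refine lintegral_mono fun t => ?_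
          rw [ENNReal.prod_rpow_of_nonneg hp0, ← ENNReal.mul_rpow_of_nonneg _ _ hp0,
            ← hroot (volume (slice t))]
          exact ENNReal.rpow_le_rpow (hle t) hp0
        _ = A ^ p * ∫⁻ t, ∏ j, g j t ^ p :=
          lintegral_const_mul _ (Finset.measurable_prod _ fun j _ => (hmeas j).pow_const p)
        _ ≤ A ^ p * ∏ j, (∫⁻ t, g j t) ^ p := by
          gcongr
          refine ENNReal.lintegral_prod_norm_pow_le _ (fun j _ => (hmeas j).aemeasurable) ?_
            fun _ _ => hp0
          rw [Finset.sum_const, Finset.card_univ, Fintype.card_fin, nsmul_eq_mul, hp,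
            mul_inv_cancel₀ hk.ne']
        _ = _ := by simp only [hg, ← volume_eq_lintegral_head (hopen _)]
    calc volume S ^ (k + 1) ≤ (A ^ p * ∏ j : Fin (k + 1), volume (j.succ.removeNth '' S) ^ p) ^ (k + 1) :=
          pow_le_pow_left' key _
      _ = _ := by
        rw [mul_pow, hpow, ← Finset.prod_pow,
          Fin.prod_univ_succ fun j : Fin (k + 2) => volume (j.removeNth '' S)]
        simp only [hpow, hA]

theorem volume_le_of_forall_ofReal_le {s : Set ℝ} {l : ℝ≥0∞}
    (h : ∀ x ∈ s, 0 < x ∧ ENNReal.ofReal x ≤ l) : volume s ≤ l := by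
  rcases eq_or_ne l ⊤ with rfl | hl
  · exact le_top
  · calc volume s ≤ volume (Set.Icc 0 l.toReal) := measure_mono fun x hx =>
          ⟨(h x hx).1.le, (ENNReal.ofReal_le_iff_le_toReal hl).1 (h x hx).2⟩
      _ = l := by simp [hl]

theorem ofReal_le_volume_fiber {n : ℕ} {K : Set (Fin (n + 1) → ℝ)} (hK : Convex ℝ K)
    {a₀ r h s : ℝ} {y₀ y z : Fin n → ℝ} (h0 : 0 < h) (hr : h < r)
    (ha : (Fin.cons a₀ y₀ : Fin (n + 1) → ℝ) ∈ K)
    (hb : (Fin.cons (a₀ + r) y₀ : Fin (n + 1) → ℝ) ∈ K)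
    (hy : (Fin.cons s y : Fin (n + 1) → ℝ) ∈ K)
    (hz : z = (h / r) • y₀ + (1 - h / r) • y) :
    ENNReal.ofReal h ≤ volume {t : ℝ | (Fin.cons t z : Fin (n + 1) → ℝ) ∈ K} := by
  have hr0 : 0 < r := h0.trans hr
  set c := (h / r) * a₀ + (1 - h / r) * s with hc
  have : ENNReal.ofReal h = volume (Set.Icc c (c + h)) := by simp
  rw [this]
  refine measure_mono fun t ht => ?_
  have h1 : 0 ≤ 1 - (t - c) / h := by
    rw [sub_nonneg, div_le_one h0]; linarith [ht.2]
  have h2 : 0 ≤ (t - c) / h := div_nonneg (by linarith [ht.1]) h0.le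
  have h3 : 0 ≤ 1 - h / r := by rw [sub_nonneg, div_le_one hr0]; exact hr.le
  have hm := hK (hK ha hb h1 h2 (by ring)) hy (div_pos h0 hr0).le h3 (by ring)
  have he : (Fin.cons t z : Fin (n + 1) → ℝ) = (h / r) • ((1 - (t - c) / h) •
      (Fin.cons a₀ y₀ : Fin (n + 1) → ℝ) + ((t - c) / h) • (Fin.cons (a₀ + r) y₀ :
        Fin (n + 1) → ℝ)) + (1 - h / r) • (Fin.cons s y : Fin (n + 1) → ℝ) := by
    ext i
    refine Fin.cases ?_ (fun i => ?_) i
    · simp only [Fin.cons_zero, Pi.add_apply, Pi.smul_apply, smul_eq_mul]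
      have : t = c + (h / r) * ((t - c) / h) * r := by field_simp; ring
      nth_rewrite 1 [this]
      rw [hc]
      ring
    · simp only [Fin.cons_succ, Pi.add_apply, Pi.smul_apply, smul_eq_mul, hz]
      ring
  rw [Set.mem_ofPred_eq, he]
  exact hm

/-- An open convex set which contains a segment of length `r` in the first coordinate direction
has at least the volume of a cone of height `r` over its projection along that direction. -/
theorem mul_volume_removeNth_zero_le {n : ℕ} {K : Set (Fin (n + 1) → ℝ)} (hK : Convex ℝ K)
    (hKo : IsOpen K) {a₀ r : ℝ} {y₀ : Fin n → ℝ} (hr : 0 < r)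
    (ha : (Fin.cons a₀ y₀ : Fin (n + 1) → ℝ) ∈ K)
    (hb : (Fin.cons (a₀ + r) y₀ : Fin (n + 1) → ℝ) ∈ K) :
    ENNReal.ofReal r * volume ((0 : Fin (n + 1)).removeNth '' K) ≤ (n + 1 : ℕ) * volume K := by
  set Q : Set (Fin n → ℝ) := (0 : Fin (n + 1)).removeNth '' K with hQ
  have hQo : IsOpen Q := isOpenMap_removeNth 0 K hKo
  set C : Set (ℝ × (Fin n → ℝ)) :=
    {q | q.1 ∈ Set.Ioo 0 r ∧ y₀ + (1 - q.1 / r)⁻¹ • (q.2 - y₀) ∈ Q} with hC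
  have hCm : MeasurableSet C := by
    refine MeasurableSet.inter (measurable_fst measurableSet_Ioo) ?_
    have : Measurable fun q : ℝ × (Fin n → ℝ) => y₀ + (1 - q.1 / r)⁻¹ • (q.2 - y₀) := by fun_prop
    exact this hQo.measurableSet
  have hle : (volume : Measure ℝ).prod (volume : Measure (Fin n → ℝ)) C ≤ volume K := by
    rw [Measure.prod_apply_symm hCm, volume_eq_lintegral_tail hKo.measurableSet]
    refine lintegral_mono fun z => volume_le_of_forall_ofReal_le ?_
    rintro h ⟨⟨h0, h1⟩, x, hx, hxz⟩
    refine ⟨h0, ofReal_le_volume_fiber hK (s := x 0) (y := Fin.tail x) h0 h1 ha hb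
      (by rwa [Fin.cons_self_tail]) ?_⟩
    have h3 : 0 < 1 - h / r := by rw [sub_pos, div_lt_one hr]; exact h1
    rw [← Fin.removeNth_zero, hxz, smul_add, smul_smul, mul_inv_cancel₀ h3.ne']
    ext i
    simp only [Pi.add_apply, Pi.smul_apply, Pi.sub_apply, smul_eq_mul]
    ring
  have hslice : ∀ h ∈ Set.Ioo 0 r, volume (Prod.mk h ⁻¹' C) =
      ENNReal.ofReal ((1 - h / r) ^ n) * volume Q := by
    intro h hh
    have h3 : 0 < 1 - h / r := by rw [sub_pos, div_lt_one hr]; exact hh.2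
    have : Prod.mk h ⁻¹' C = AffineMap.homothety y₀ (1 - h / r) '' Q := by
      ext z
      constructor
      · rintro ⟨-, hz⟩
        refine ⟨_, hz, ?_⟩
        simp [AffineMap.homothety_apply, smul_smul, mul_inv_cancel₀ h3.ne']
      · rintro ⟨y, hy, rfl⟩
        refine ⟨hh, ?_⟩
        simpa [AffineMap.homothety_apply, smul_smul, inv_mul_cancel₀ h3.ne'] using hy
    rw [this, Measure.addHaar_image_homothety, Module.finrank_fin_fun,
      abs_of_nonneg (pow_nonneg h3.le n)]
  have hint : ∫⁻ h in Set.Ioo 0 r, ENNReal.ofReal ((1 - h / r) ^ n) =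
      ENNReal.ofReal (r / (n + 1)) := by
    rw [setLIntegral_congr Ioo_ae_eq_Ioc, ← ofReal_integral_eq_lintegral_ofReal,
      ← intervalIntegral.integral_of_le hr.le]
    · congr 1
      have := intervalIntegral.integral_comp_div (a := 0) (b := r) (fun x : ℝ => (1 - x) ^ n) hr.ne'
      rw [this, intervalIntegral.integral_comp_sub_left (fun x : ℝ => x ^ n)]
      simp [hr.ne', div_eq_mul_inv]
    · exact (Continuous.integrableOn_Icc (by fun_prop)).mono_set Set.Ioc_subset_Icc_self
    · refine (ae_restrict_iff' measurableSet_Ioc).2 (.of_forall fun h hh => ?_)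
      have : h / r ≤ 1 := (div_le_one hr).2 hh.2
      exact pow_nonneg (by linarith) n
  have hge : ENNReal.ofReal (r / (n + 1)) * volume Q ≤ volume K :=
    calc ENNReal.ofReal (r / (n + 1)) * volume Q
        = ∫⁻ h in Set.Ioo 0 r, volume (Prod.mk h ⁻¹' C) := by
          rw [setLIntegral_congr_fun measurableSet_Ioo hslice, lintegral_mul_const _ (by fun_prop),
            hint]
      _ ≤ ∫⁻ h, volume (Prod.mk h ⁻¹' C) := setLIntegral_le_lintegral _ _
      _ ≤ volume K := by rwa [← Measure.prod_apply hCm]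
  calc ENNReal.ofReal r * volume Q
      = (n + 1 : ℕ) * (ENNReal.ofReal (r / (n + 1)) * volume Q) := by
        rw [← mul_assoc, ← ENNReal.ofReal_natCast, ← ENNReal.ofReal_mul (by positivity)]
        congr 2
        push_cast
        field_simp
    _ ≤ _ := by gcongr

theorem exists_pos_add_smul_mem_frontier {E : Type*} [NormedAddCommGroup E] [NormedSpace ℝ E]
    {s : Set E} (hs : IsOpen s) (hb : IsBounded s) {x v : E} (hx : x ∈ s) (hv : v ≠ 0) :
    ∃ t : ℝ, 0 < t ∧ x + t • v ∈ frontier s := by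
  set f : ℝ → E := fun t => x + |t| • v with hf
  have hfc : Continuous f := by fun_prop
  have huniv : f ⁻¹' s ≠ Set.univ := by
    intro h
    obtain ⟨C, hC⟩ := isBounded_iff_forall_norm_le.1 hb
    have hv' : 0 < ‖v‖ := norm_pos_iff.2 hv
    have h1 := hC _ (h.ge (Set.mem_univ ((C + ‖x‖ + 1) / ‖v‖)))
    have hC0 : 0 ≤ C := (norm_nonneg x).trans (hC x hx)
    have h2 : ‖|(C + ‖x‖ + 1) / ‖v‖| • v‖ = C + ‖x‖ + 1 := by
      rw [norm_smul, Real.norm_eq_abs, abs_abs, abs_of_nonneg (by positivity)]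
      field_simp
    have h3 := norm_sub_le (f ((C + ‖x‖ + 1) / ‖v‖)) x
    rw [hf, add_sub_cancel_left, h2] at h3
    linarith
  obtain ⟨t, ht⟩ := nonempty_frontier_iff.2 ⟨⟨0, by simpa [hf] using hx⟩, huniv⟩
  rw [(hs.preimage hfc).frontier_eq] at ht
  refine ⟨|t|, abs_pos.2 ?_, ?_⟩
  · rintro rfl
    exact ht.2 (by simpa [hf] using hx)
  · rw [hs.frontier_eq]
    exact ⟨hfc.closure_preimage_subset s ht.1, ht.2⟩

theorem lipschitzWith_removeNth {m : ℕ} (i : Fin (m + 1)) :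
    LipschitzWith 1 fun x : EuclideanSpace ℝ (Fin (m + 1)) => (i.removeNth x.ofLp : Fin m → ℝ) := by
  have h : LipschitzWith 1 (i.removeNth : (Fin (m + 1) → ℝ) → Fin m → ℝ) :=
    LipschitzWith.of_edist_le fun x y => edist_pi_le_iff.2 fun j =>
      edist_le_pi_edist x y (i.succAbove j)
  have h' := h.comp (PiLp.lipschitzWith_ofLp 2 fun _ : Fin (m + 1) => ℝ)
  rwa [mul_one] at h'

theorem volume_image_removeNth_le {m : ℕ} (i : Fin (m + 1))
    (s : Set (EuclideanSpace ℝ (Fin (m + 1)))) :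
    volume ((fun x => (i.removeNth x.ofLp : Fin m → ℝ)) '' s) ≤ μH[m] s := by
  have h := (lipschitzWith_removeNth i).hausdorffMeasure_image_le (Nat.cast_nonneg m) s
  have hv := hausdorffMeasure_pi_real (ι := Fin m)
  rw [Fintype.card_fin] at hv
  simpa [hv] using h

/-- The boundary of a bounded open convex set consists of two sheets over each projection. -/
theorem two_mul_volume_image_removeNth_le {m : ℕ} (i : Fin (m + 1))
    {Ω : Set (EuclideanSpace ℝ (Fin (m + 1)))} (ho : IsOpen Ω) (hb : IsBounded Ω)
    (hc : Convex ℝ Ω) :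
    2 * volume ((fun x => (i.removeNth x.ofLp : Fin m → ℝ)) '' Ω) ≤ μH[m] (frontier Ω) := by
  set e : EuclideanSpace ℝ (Fin (m + 1)) := EuclideanSpace.single i 1 with he
  have he0 : e ≠ 0 := by simp [he]
  set sheet : EuclideanSpace ℝ (Fin (m + 1)) → Set (EuclideanSpace ℝ (Fin (m + 1))) :=
    fun v => {x | ∃ t : ℝ, 0 < t ∧ x - t • v ∈ Ω} with hsheet
  have hopen : ∀ v, IsOpen (sheet v) := fun v => by
    have : sheet v = ⋃ t ∈ Set.Ioi (0 : ℝ), (fun x => x - t • v) ⁻¹' Ω := by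
      ext x
      simp [hsheet]
    rw [this]
    exact isOpen_biUnion fun t _ => ho.preimage (by fun_prop)
  have hproj : ∀ v ∈ ({e, -e} : Set _), volume ((fun x => (i.removeNth x.ofLp : Fin m → ℝ)) '' Ω) ≤
      μH[m] (frontier Ω ∩ sheet v) := by
    intro v hv
    refine le_trans (measure_mono ?_) (volume_image_removeNth_le i (frontier Ω ∩ sheet v))
    rintro _ ⟨x, hx, rfl⟩
    have hv0 : v ≠ 0 := by
      rcases hv with rfl | rfl
      exacts [he0, neg_ne_zero.2 he0]
    obtain ⟨t, ht, htx⟩ := exists_pos_add_smul_mem_frontier ho hb hx hv0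
    refine ⟨x + t • v, ⟨htx, t, ht, by simpa using hx⟩, ?_⟩
    ext j
    rcases hv with rfl | rfl <;> simp [Fin.removeNth, he]
  have hdisj : Disjoint (frontier Ω ∩ sheet e) (frontier Ω ∩ sheet (-e)) := by
    refine Set.disjoint_left.2 ?_
    rintro x ⟨hx, t, ht, htx⟩ ⟨-, s, hs, hsx⟩
    refine (ho.frontier_eq ▸ hx).2 ?_
    have hts : 0 < t + s := by positivity
    have := hc htx hsx (div_pos hs hts).le (div_pos ht hts).le (by field_simp; ring)
    convert this using 1
    have h1 : s / (t + s) + t / (t + s) = 1 := by field_simp; ring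
    calc x = (s / (t + s) + t / (t + s)) • x := by rw [h1, one_smul]
      _ = _ := by
        ext j
        simp only [PiLp.smul_apply, PiLp.add_apply, PiLp.sub_apply, PiLp.neg_apply, smul_eq_mul]
        field_simp
        ring
  calc 2 * volume ((fun x => (i.removeNth x.ofLp : Fin m → ℝ)) '' Ω)
      ≤ μH[m] (frontier Ω ∩ sheet e) + μH[m] (frontier Ω ∩ sheet (-e)) := by
        rw [two_mul]
        exact add_le_add (hproj e (by simp)) (hproj (-e) (by simp))
    _ = μH[m] (frontier Ω ∩ sheet e ∪ frontier Ω ∩ sheet (-e)) :=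
        (measure_union hdisj (isClosed_frontier.measurableSet.inter (hopen _).measurableSet)).symm
    _ ≤ μH[m] (frontier Ω) :=
        measure_mono (Set.union_subset Set.inter_subset_left Set.inter_subset_left)

theorem hausdorffMeasure_sphere_sup_lt_top (m : ℕ) (R : ℝ) :
    μH[m] {y : EuclideanSpace ℝ (Fin (m + 1)) | ‖y.ofLp‖ = R} < ⊤ := by
  set face : Fin (m + 1) → ℝ → (Fin m → ℝ) → EuclideanSpace ℝ (Fin (m + 1)) :=
    fun i s y => WithLp.toLp 2 (i.insertNth s y : Fin (m + 1) → ℝ) with hface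
  have hfin : ∀ i s, μH[m] (face i s '' Metric.closedBall 0 R) < ⊤ := by
    intro i s
    have h1 : LipschitzWith 1 fun y : Fin m → ℝ => (i.insertNth s y : Fin (m + 1) → ℝ) :=
      LipschitzWith.of_edist_le fun x y => edist_pi_le_iff.2 fun j => by
        refine Fin.succAboveCases i ?_ (fun j => ?_) j
        · simp
        · simpa using edist_le_pi_edist x y j
    have h2 := (PiLp.lipschitzWith_toLp 2 fun _ : Fin (m + 1) => ℝ).comp h1
    have h3 := h2.hausdorffMeasure_image_le (Nat.cast_nonneg m) (Metric.closedBall 0 R)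
    have hv := hausdorffMeasure_pi_real (ι := Fin m)
    rw [Fintype.card_fin] at hv
    refine h3.trans_lt ?_
    rw [hv]
    exact ENNReal.mul_lt_top (ENNReal.rpow_lt_top_of_nonneg (Nat.cast_nonneg m)
      ENNReal.coe_ne_top) measure_closedBall_lt_top
  have hsub : {y : EuclideanSpace ℝ (Fin (m + 1)) | ‖y.ofLp‖ = R} ⊆
      ⋃ i, (face i R '' Metric.closedBall 0 R ∪ face i (-R) '' Metric.closedBall 0 R) := by
    intro y hy
    have hy' : ‖y.ofLp‖ = R := hy
    have hR : 0 ≤ R := hy' ▸ norm_nonneg _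
    obtain ⟨i, himax⟩ := Finite.exists_max fun j => ‖y.ofLp j‖
    have hi : ‖y.ofLp i‖ = ‖y.ofLp‖ := (norm_le_pi_norm _ i).antisymm
      ((pi_norm_le_iff_of_nonneg (norm_nonneg _)).2 himax)
    have hmem : (i.removeNth y.ofLp : Fin m → ℝ) ∈ Metric.closedBall 0 R := by
      rw [mem_closedBall_zero_iff, pi_norm_le_iff_of_nonneg hR]
      exact fun j => (norm_le_pi_norm y.ofLp _).trans hy'.le
    rw [hy', Real.norm_eq_abs, abs_eq hR] at hi
    refine Set.mem_iUnion.2 ⟨i, hi.imp (fun h => ⟨_, hmem, ?_⟩) fun h => ⟨_, hmem, ?_⟩⟩ <;>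
      simp [hface, ← h]
  exact ((measure_mono hsub).trans (measure_iUnion_fintype_le _ _)).trans_lt
    (ENNReal.sum_lt_top.2 fun i _ => measure_union_lt_top (hfin i R) (hfin i (-R)))

theorem hausdorffMeasure_frontier_lt_top {m : ℕ} {Ω : Set (EuclideanSpace ℝ (Fin (m + 1)))}
    (ho : IsOpen Ω) (hb : IsBounded Ω) (hc : Convex ℝ Ω) (hne : Ω.Nonempty) :
    μH[m] (frontier Ω) < ⊤ := by
  obtain ⟨R, hR⟩ := isBounded_iff_forall_norm_le.1 hb.closure
  have hR0 : 0 ≤ R := (norm_nonneg _).trans (hR _ (subset_closure hne.some_mem))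
  have hlip := PiLp.lipschitzWith_ofLp 2 fun _ : Fin (m + 1) => ℝ
  have hnormal : ∀ x : frontier Ω, ∃ y : EuclideanSpace ℝ (Fin (m + 1)), ‖y.ofLp‖ = R + 1 ∧
      ∀ z ∈ frontier Ω, inner ℝ (y - x) (z - x) ≤ 0 := by
    rintro ⟨x, hx⟩
    obtain ⟨f, hf⟩ := geometric_hahn_banach_open_point hc ho (ho.frontier_eq ▸ hx).2
    set n := (InnerProductSpace.toDual ℝ _).symm f with hn
    have hfn : ∀ z, inner ℝ n z = f z := fun z => InnerProductSpace.toDual_symm_apply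
    have hn0 : n ≠ 0 := by
      intro h
      have := hf _ hne.some_mem
      simp [← hfn, h] at this
    have hcl : ∀ z ∈ closure Ω, f z ≤ f x := fun z hz =>
      closure_minimal (fun w hw => (hf w hw).le : Ω ⊆ {w | f w ≤ f x})
        (isClosed_le f.continuous continuous_const) hz
    have hxR : x.ofLp ∈ Metric.ball (0 : Fin (m + 1) → ℝ) (R + 1) := by
      have h := hlip.dist_le_mul x 0
      simp only [NNReal.coe_one, one_mul, dist_zero_right, WithLp.ofLp_zero] at h
      rw [mem_ball_zero_iff]
      linarith [hR x (frontier_subset_closure hx)]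
    obtain ⟨t, ht, hty⟩ := exists_pos_add_smul_mem_frontier Metric.isOpen_ball
      Metric.isBounded_ball hxR (v := n.ofLp) (by simpa using hn0)
    rw [frontier_ball _ (by linarith), mem_sphere_zero_iff_norm] at hty
    refine ⟨x + t • n, hty, fun z hz => ?_⟩
    rw [add_sub_cancel_left, real_inner_smul_left, inner_sub_right, hfn, hfn]
    exact mul_nonpos_of_nonneg_of_nonpos ht.le
      (sub_nonpos.2 (hcl z (frontier_subset_closure hz)))
  choose g hgR hg using hnormal
  have hanti : AntilipschitzWith 1 g := by
    refine AntilipschitzWith.of_le_mul_dist fun x x' => ?_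
    rw [NNReal.coe_one, one_mul, Subtype.dist_eq, dist_eq_norm, dist_eq_norm]
    set u : EuclideanSpace ℝ (Fin (m + 1)) := (x : EuclideanSpace ℝ (Fin (m + 1))) - x' with hu
    have h1 := hg x x' x'.2
    have h2 := hg x' x x.2
    have h3 : ‖u‖ * ‖u‖ ≤ inner ℝ (g x - g x') u := by
      rw [← real_inner_self_eq_norm_mul_norm]
      have h4 : (x' : EuclideanSpace ℝ (Fin (m + 1))) - x = -u := by rw [hu, neg_sub]
      rw [h4, inner_neg_right] at h1
      have h5 : g x - g x' = (g x - x) - (g x' - x') + u := by rw [hu]; abel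
      have h6 : inner ℝ (g x - g x') u =
          inner ℝ (g x - x) u - inner ℝ (g x' - x') u + inner ℝ u u := by
        rw [← inner_sub_left, ← inner_add_left, ← h5]
      rw [← hu] at h2
      linarith
    have h4 := h3.trans (real_inner_le_norm _ _)
    rcases (norm_nonneg u).eq_or_lt with h0 | h0
    · rw [← h0]; exact norm_nonneg _
    · exact le_of_mul_le_mul_right h4 h0
  have himage : Subtype.val '' (Set.univ : Set (frontier Ω)) = frontier Ω := by simp
  calc μH[m] (frontier Ω) = μH[m] (Set.univ : Set (frontier Ω)) := by
        conv_lhs => rw [← himage]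
        exact isometry_subtype_coe.hausdorffMeasure_image (Or.inl (Nat.cast_nonneg m)) _
    _ ≤ (1 : NNReal) ^ (m : ℝ) * μH[m] (g '' Set.univ) :=
        hanti.le_hausdorffMeasure_image (Nat.cast_nonneg m) _
    _ = μH[m] (g '' Set.univ) := by simp
    _ ≤ μH[m] {y : EuclideanSpace ℝ (Fin (m + 1)) | ‖y.ofLp‖ = R + 1} :=
        measure_mono (by rintro _ ⟨x, -, rfl⟩; exact hgR x)
    _ < ⊤ := hausdorffMeasure_sphere_sup_lt_top m _

theorem volume_le_ofReal_diam_mul {n : ℕ} {Ω : Set (EuclideanSpace ℝ (Fin (n + 1)))}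
    (ho : IsOpen Ω) (hb : IsBounded Ω) :
    volume Ω ≤ ENNReal.ofReal (diam Ω) *
      volume ((fun x => ((0 : Fin (n + 1)).removeNth x.ofLp : Fin n → ℝ)) '' Ω) := by
  set W : Set (Fin (n + 1) → ℝ) := WithLp.toLp 2 ⁻¹' Ω with hW
  have hWo : IsOpen W := ho.preimage (PiLp.continuous_toLp 2 _)
  set B := (fun x => ((0 : Fin (n + 1)).removeNth x.ofLp : Fin n → ℝ)) '' Ω with hB
  have hBm : MeasurableSet B := by
    have : B = (0 : Fin (n + 1)).removeNth '' W := by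
      ext y
      exact ⟨fun ⟨x, hx, h⟩ => ⟨x.ofLp, hx, h⟩, fun ⟨x, hx, h⟩ => ⟨WithLp.toLp 2 x, hx, h⟩⟩
    rw [this]
    exact (isOpenMap_removeNth 0 W hWo).measurableSet
  rw [← (PiLp.volume_preserving_toLp (Fin (n + 1))).measure_preimage
    ho.measurableSet.nullMeasurableSet, volume_eq_lintegral_tail hWo.measurableSet]
  calc ∫⁻ y : Fin n → ℝ, volume {t : ℝ | (Fin.cons t y : Fin (n + 1) → ℝ) ∈ W}
      ≤ ∫⁻ y, B.indicator (fun _ => ENNReal.ofReal (diam Ω)) y := by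
        refine lintegral_mono fun y => ?_
        by_cases hy : y ∈ B
        · rw [Set.indicator_of_mem hy]
          refine (Real.volume_le_diam _).trans (Metric.ediam_le fun t ht s hs => ?_)
          rw [edist_dist]
          refine ENNReal.ofReal_le_ofReal (le_trans ?_ (dist_le_diam_of_mem hb ht hs))
          have := PiLp.norm_apply_le (p := 2) (WithLp.toLp 2 (Fin.cons t y : Fin (n + 1) → ℝ) -
            WithLp.toLp 2 (Fin.cons s y : Fin (n + 1) → ℝ)) 0
          simpa [dist_eq_norm] using this
        · have : {t : ℝ | (Fin.cons t y : Fin (n + 1) → ℝ) ∈ W} = ∅ :=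
            Set.eq_empty_of_forall_notMem fun t ht => hy ⟨_, ht, by simp [Fin.removeNth_zero]⟩
          simp [this]
    _ = _ := by rw [lintegral_indicator_const hBm]

theorem pow_mul_volume_pow_le_of_segment {k : ℕ} {Ω : Set (EuclideanSpace ℝ (Fin (k + 2)))}
    (ho : IsOpen Ω) (hb : IsBounded Ω) (hc : Convex ℝ Ω) {a : EuclideanSpace ℝ (Fin (k + 2))}
    {r : ℝ} (hr : 0 < r) (ha : a ∈ Ω) (har : a + r • EuclideanSpace.single 0 1 ∈ Ω) :
    (2 * ENNReal.ofReal r) ^ (k + 1) * volume Ω ^ k ≤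
      ENNReal.ofReal (diam Ω) ^ k * ((k + 1 : ℕ) * μH[(k + 1 : ℕ)] (frontier Ω)) ^ (k + 1) := by
  set W : Set (Fin (k + 2) → ℝ) := WithLp.toLp 2 ⁻¹' Ω with hW
  have hWo : IsOpen W := ho.preimage (PiLp.continuous_toLp 2 _)
  have hWc : Convex ℝ W := fun x hx y hy s t hs ht hst => hc hx hy hs ht hst
  have himg : ∀ i : Fin (k + 2), (fun x => (i.removeNth x.ofLp : Fin (k + 1) → ℝ)) '' Ω =
      i.removeNth '' W := fun i => by
    ext y
    exact ⟨fun ⟨x, hx, h⟩ => ⟨x.ofLp, hx, h⟩, fun ⟨x, hx, h⟩ => ⟨WithLp.toLp 2 x, hx, h⟩⟩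
  set B : Set (Fin (k + 1) → ℝ) := (0 : Fin (k + 2)).removeNth '' W with hB
  have hBo : IsOpen B := isOpenMap_removeNth 0 W hWo
  have hBne : B.Nonempty := Set.Nonempty.image _ ⟨a.ofLp, ha⟩
  have hVB : volume Ω ≤ ENNReal.ofReal (diam Ω) * volume B := by
    rw [hB, ← himg]
    exact volume_le_ofReal_diam_mul ho hb
  have hfactor : ∀ j : Fin (k + 1), 2 * ENNReal.ofReal r * volume (j.removeNth '' B) ≤
      (k + 1 : ℕ) * μH[(k + 1 : ℕ)] (frontier Ω) := by
    intro j
    set K : Set (Fin (k + 1) → ℝ) := j.succ.removeNth '' W with hK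
    have hmem : (j.succ.removeNth a.ofLp : Fin (k + 1) → ℝ) ∈ K := ⟨a.ofLp, ha, rfl⟩
    have hmem' : (j.succ.removeNth (a + r • EuclideanSpace.single 0 1).ofLp : Fin (k + 1) → ℝ) ∈ K :=
      ⟨_, har, rfl⟩
    have hBK : j.removeNth '' B = (0 : Fin (k + 1)).removeNth '' K := by
      rw [hB, hK, Set.image_image, Set.image_image]
      exact Set.image_congr fun x _ => (removeNth_zero_removeNth_succ j x).symm
    have hcone := mul_volume_removeNth_zero_le (hWc.is_linear_image (isLinearMap_removeNth _))
      (isOpenMap_removeNth _ W hWo) (a₀ := a 0)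
      (y₀ := Fin.tail (j.succ.removeNth a.ofLp : Fin (k + 1) → ℝ)) hr
      (by
        convert hmem using 1
        ext i
        refine Fin.cases ?_ (fun i => ?_) i <;> simp [Fin.removeNth, Fin.tail])
      (by
        convert hmem' using 1
        ext i
        refine Fin.cases ?_ (fun i => ?_) i <;> simp [Fin.removeNth, Fin.tail])
    calc 2 * ENNReal.ofReal r * volume (j.removeNth '' B)
        = 2 * (ENNReal.ofReal r * volume ((0 : Fin (k + 1)).removeNth '' K)) := by
          rw [hBK, mul_assoc]
      _ ≤ 2 * ((k + 1 : ℕ) * volume K) := by gcongr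
      _ = (k + 1 : ℕ) * (2 * volume K) := by ring
      _ ≤ _ := by
        gcongr
        rw [hK, ← himg]
        exact two_mul_volume_image_removeNth_le _ ho hb hc
  calc (2 * ENNReal.ofReal r) ^ (k + 1) * volume Ω ^ k
      ≤ (2 * ENNReal.ofReal r) ^ (k + 1) * (ENNReal.ofReal (diam Ω) * volume B) ^ k := by gcongr
    _ = ENNReal.ofReal (diam Ω) ^ k * ((2 * ENNReal.ofReal r) ^ (k + 1) * volume B ^ k) := by ring
    _ ≤ ENNReal.ofReal (diam Ω) ^ k * ((2 * ENNReal.ofReal r) ^ (k + 1) *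
          ∏ j : Fin (k + 1), volume (j.removeNth '' B)) := by
        gcongr
        exact volume_pow_le_prod_volume_removeNth k B hBo hBne
    _ = ENNReal.ofReal (diam Ω) ^ k *
          ∏ j : Fin (k + 1), (2 * ENNReal.ofReal r * volume (j.removeNth '' B)) := by
        rw [Finset.prod_mul_distrib, Finset.prod_const, Finset.card_univ, Fintype.card_fin]
    _ ≤ ENNReal.ofReal (diam Ω) ^ k *
          ∏ _j : Fin (k + 1), ((k + 1 : ℕ) * μH[(k + 1 : ℕ)] (frontier Ω)) := by
        exact mul_le_mul' le_rfl (Finset.prod_le_prod' fun j _ => hfactor j)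
    _ = _ := by rw [Finset.prod_const, Finset.card_univ, Fintype.card_fin]

theorem exists_linearIsometryEquiv_map_eq_single {n : ℕ} (v : EuclideanSpace ℝ (Fin (n + 1)))
    (hv : v ≠ 0) : ∃ L : EuclideanSpace ℝ (Fin (n + 1)) ≃ₗᵢ[ℝ] EuclideanSpace ℝ (Fin (n + 1)),
      L v = ‖v‖ • EuclideanSpace.single 0 1 := by
  have hv' : ‖v‖ ≠ 0 := norm_ne_zero_iff.2 hv
  obtain ⟨b, hb⟩ := Orthonormal.exists_orthonormalBasis_extension_of_card_eq (𝕜 := ℝ)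
    (E := EuclideanSpace ℝ (Fin (n + 1))) (ι := Fin (n + 1)) (by simp)
    (v := fun _ => ‖v‖⁻¹ • v) (s := {0})
    ⟨fun _ => by simp [Set.domRestrict, norm_smul, hv'],
      fun i j h => absurd (Subsingleton.elim i j) h⟩
  refine ⟨b.repr, ?_⟩
  rw [← b.repr_self, hb 0 rfl, ← map_smul, smul_smul, mul_inv_cancel₀ hv', one_smul]

theorem pow_mul_volume_pow_le {k : ℕ} {Ω : Set (EuclideanSpace ℝ (Fin (k + 2)))}
    (ho : IsOpen Ω) (hb : IsBounded Ω) (hc : Convex ℝ Ω) {a b : EuclideanSpace ℝ (Fin (k + 2))}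
    (ha : a ∈ Ω) (hbm : b ∈ Ω) :
    (2 * ENNReal.ofReal (dist a b)) ^ (k + 1) * volume Ω ^ k ≤
      ENNReal.ofReal (diam Ω) ^ k * ((k + 1 : ℕ) * μH[(k + 1 : ℕ)] (frontier Ω)) ^ (k + 1) := by
  rcases eq_or_ne a b with rfl | hab
  · simp
  obtain ⟨L, hL⟩ := exists_linearIsometryEquiv_map_eq_single (b - a) (sub_ne_zero.2 hab.symm)
  rw [← dist_eq_norm, dist_comm, map_sub, sub_eq_iff_eq_add'] at hL
  have hLb : L a + dist a b • EuclideanSpace.single 0 1 ∈ L '' Ω := ⟨b, hbm, hL⟩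
  have hLo : IsOpen (L '' Ω) := L.toHomeomorph.isOpenMap Ω ho
  have h := pow_mul_volume_pow_le_of_segment hLo
    (L.lipschitz.isBounded_image hb) (hc.linear_image L.toLinearEquiv.toLinearMap)
    (dist_pos.2 hab) ⟨a, ha, rfl⟩ hLb
  have hvol : volume (L '' Ω) = volume Ω := by
    rw [← L.measurePreserving.measure_preimage hLo.measurableSet.nullMeasurableSet,
      Set.preimage_image_eq Ω L.injective]
  have hfr : frontier (L '' Ω) = L '' frontier Ω := (L.toHomeomorph.image_frontier Ω).symm
  have hmu : μH[(k + 1 : ℕ)] (L '' frontier Ω) = μH[(k + 1 : ℕ)] (frontier Ω) :=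
    L.isometry.hausdorffMeasure_image (Or.inl (Nat.cast_nonneg _)) _
  have hd : diam (L '' Ω) = diam Ω := L.isometry.diam_image Ω
  rwa [hvol, hfr, hmu, hd] at h

theorem le_of_forall_lt_imp_le_of_continuous {f : ℝ → ℝ} {D c : ℝ} (hD : 0 < D)
    (hf : Continuous f) (h : ∀ r, 0 ≤ r → r < D → f r ≤ c) : f D ≤ c := by
  have hmem : D ∈ closure (Set.Ico 0 D) := by
    rw [closure_Ico hD.ne]
    exact Set.right_mem_Icc.2 hD.le
  exact closure_minimal (fun r hr => h r hr.1 hr.2 : Set.Ico 0 D ⊆ {r | f r ≤ c})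
    (isClosed_le hf continuous_const) hmem

theorem toReal_pow_mul_pow_le {k : ℕ} {r D : ℝ} {V P : ℝ≥0∞} (hr : 0 ≤ r) (hD : 0 ≤ D)
    (hP : P ≠ ⊤) (h : (2 * ENNReal.ofReal r) ^ (k + 1) * V ^ k ≤
      ENNReal.ofReal D ^ k * ((k + 1 : ℕ) * P) ^ (k + 1)) :
    (2 * r) ^ (k + 1) * V.toReal ^ k ≤ D ^ k * ((k + 1) * P.toReal) ^ (k + 1) := by
  have h' := ENNReal.toReal_mono (ENNReal.mul_ne_top (ENNReal.pow_ne_top ENNReal.ofReal_ne_top)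
    (ENNReal.pow_ne_top (ENNReal.mul_ne_top (ENNReal.natCast_ne_top _) hP))) h
  simp only [ENNReal.toReal_mul, ENNReal.toReal_pow, ENNReal.toReal_ofReal hr,
    ENNReal.toReal_ofReal hD, ENNReal.toReal_ofNat, ENNReal.toReal_natCast] at h'
  rwa [Nat.cast_succ] at h'

theorem diam_mul_volume_pow_le {k : ℕ} {Ω : Set (EuclideanSpace ℝ (Fin (k + 2)))}
    (hne : Ω.Nonempty) (ho : IsOpen Ω) (hb : IsBounded Ω) (hc : Convex ℝ Ω) :
    2 ^ (k + 1) * diam Ω * (volume Ω).toReal ^ k ≤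
      ((k + 1) * (μH[(k + 1 : ℕ)] (frontier Ω)).toReal) ^ (k + 1) := by
  set V := (volume Ω).toReal
  set P := (μH[(k + 1 : ℕ)] (frontier Ω)).toReal
  rcases (diam_nonneg (s := Ω)).eq_or_lt with h0 | hD
  · rw [← h0]
    simp only [mul_zero, zero_mul]
    positivity
  have hdist : ∀ a ∈ Ω, ∀ b ∈ Ω,
      (2 * dist a b) ^ (k + 1) * V ^ k ≤ diam Ω ^ k * ((k + 1) * P) ^ (k + 1) := by
    intro a ha b hbm
    exact toReal_pow_mul_pow_le dist_nonneg diam_nonneg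
      (hausdorffMeasure_frontier_lt_top ho hb hc hne).ne (pow_mul_volume_pow_le ho hb hc ha hbm)
  have hle : (2 * diam Ω) ^ (k + 1) * V ^ k ≤ diam Ω ^ k * ((k + 1) * P) ^ (k + 1) := by
    refine le_of_forall_lt_imp_le_of_continuous hD (f := fun r => (2 * r) ^ (k + 1) * V ^ k)
      (by fun_prop) fun r hr0 hr => ?_
    by_contra! hlt
    refine hr.not_ge (diam_le_of_forall_dist_le hr0 fun a ha b hbm => ?_)
    by_contra! hab
    refine hlt.not_ge (le_trans ?_ (hdist a ha b hbm))
    gcongr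
  refine le_of_mul_le_mul_left (le_trans (le_of_eq ?_) hle) (pow_pos hD k)
  rw [mul_pow]
  ring

theorem volume_euclideanBall_le (d : ℕ) :
    (volume (ball (0 : EuclideanSpace ℝ (Fin d)) 1)).toReal ≤ 2 ^ d := by
  have h : volume (ball (0 : EuclideanSpace ℝ (Fin d)) 1) ≤ ENNReal.ofReal (2 ^ d) :=
    calc volume (ball (0 : EuclideanSpace ℝ (Fin d)) 1)
        ≤ volume (WithLp.ofLp ⁻¹' ball (0 : Fin d → ℝ) 1 : Set (EuclideanSpace ℝ (Fin d))) := by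
          refine measure_mono fun x hx => ?_
          have h := (PiLp.lipschitzWith_ofLp 2 fun _ : Fin d => ℝ).dist_le_mul x 0
          simp only [NNReal.coe_one, one_mul, WithLp.ofLp_zero] at h
          exact h.trans_lt hx
      _ = ENNReal.ofReal (2 ^ d) := by
          rw [(PiLp.volume_preserving_ofLp (Fin d)).measure_preimage
            isOpen_ball.measurableSet.nullMeasurableSet, Real.volume_pi_ball _ one_pos]
          simp
  exact ENNReal.toReal_le_of_le_ofReal (by positivity) h

end ConvexDiam

theorem diam_le_perim_pow (d : ℕ) (hd : 2 ≤ d)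
    (Ω : Set (EuclideanSpace ℝ (Fin d))) (hne : Ω.Nonempty) (hΩ : IsOpen Ω)
    (hbdd : IsBounded Ω) (hconv : Convex ℝ Ω) :
    diam Ω ≤ (2 * (d : ℝ) ^ ((d : ℝ) - 1) /
        (volume (ball (0 : EuclideanSpace ℝ (Fin d)) 1)).toReal) *
      (perim d Ω ^ ((d : ℝ) - 1) / (volume Ω).toReal ^ ((d : ℝ) - 2)) := by
  obtain ⟨k, rfl⟩ := Nat.exists_eq_add_of_le' hd
  have h1 : ((k + 2 : ℕ) : ℝ) - 1 = ((k + 1 : ℕ) : ℝ) := by push_cast; ring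
  have h2 : ((k + 2 : ℕ) : ℝ) - 2 = (k : ℝ) := by push_cast; ring
  rw [perim, h1, h2, Real.rpow_natCast, Real.rpow_natCast, Real.rpow_natCast]
  have hmain := ConvexDiam.diam_mul_volume_pow_le hne hΩ hbdd hconv
  have hω := ConvexDiam.volume_euclideanBall_le (k + 2)
  set ω := (volume (ball (0 : EuclideanSpace ℝ (Fin (k + 2))) 1)).toReal
  set V := (volume Ω).toReal
  set P := (μH[(k + 1 : ℕ)] (frontier Ω)).toReal
  have hω0 : 0 < ω := ENNReal.toReal_pos (measure_ball_pos _ _ one_pos).ne' measure_ball_lt_top.ne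
  have hV0 : 0 < V := ENNReal.toReal_pos (hΩ.measure_pos _ hne).ne' hbdd.measure_lt_top.ne
  have hP0 : 0 ≤ P := ENNReal.toReal_nonneg
  have hD0 : 0 ≤ diam Ω := diam_nonneg
  rw [div_mul_div_comm, le_div_iff₀ (by positivity)]
  calc diam Ω * (ω * V ^ k) ≤ diam Ω * (2 ^ (k + 2) * V ^ k) := by gcongr
    _ = 2 * (2 ^ (k + 1) * diam Ω * V ^ k) := by ring
    _ ≤ 2 * ((k + 1) * P) ^ (k + 1) := by gcongr
    _ ≤ 2 * (((k + 2 : ℕ) : ℝ) * P) ^ (k + 1) := by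
      gcongr
      push_cast
      linarith
    _ = 2 * ((k + 2 : ℕ) : ℝ) ^ (k + 1) * P ^ (k + 1) := by rw [mul_pow]; ring
end
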